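/- arXiv:1210.5705 — 3 statements merged into one kernel-verified Lean document; each statement's English description precedes it below -/
import Mathlib

section
/- The infimum, over all functions u : ℝ³ → ℝ of class C² with compact support contained in ℝ³ \ {0} and with ∫_{ℝ³} |x|^{-2} |∇u(x)|² dx ≠ 0, of the quotient (∫_{ℝ³} |Δu(x)|² dx) / (∫_{ℝ³} |x|^{-2} |∇u(x)|² dx) equals 25/36. In particular ∫_{ℝ³} |Δu|² dx ≥ (25/36) ∫_{ℝ³} |x|^{-2} |∇u|² dx for all such u, and 25/36 is the best constant. -/
open MeasureTheory

noncomputable def lap {n : ℕ} (u : EuclideanSpace ℝ (Fin n) → ℝ)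
    (x : EuclideanSpace ℝ (Fin n)) : ℝ :=
  ∑ i : Fin n, iteratedFDeriv ℝ 2 u x ![EuclideanSpace.single i 1, EuclideanSpace.single i 1]

namespace HardyRellich

open Set Filter Topology Distributions
open scoped ContDiff

/-- The algebraic core of the inequality: a bilinear form for which the Euler operator `E` is
skew up to the identity and the rotations `L i` are skew. -/
theorem le_of_skew {V : Type*} [AddCommGroup V] [Module ℝ V] (B : V →ₗ[ℝ] V →ₗ[ℝ] ℝ)
    (E : V →ₗ[ℝ] V) (L : Fin 3 → V →ₗ[ℝ] V) (hsymm : ∀ f g, B f g = B g f)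
    (hnonneg : ∀ f, 0 ≤ B f f) (hE : ∀ f g, B (E f) g = B f g - B f (E g))
    (hL : ∀ i f g, B (L i f) g = -B f (L i g)) (hLE : ∀ i f, L i (E f) = E (L i f))
    (hLL : ∀ i f, L i (L (i + 1) f) - L (i + 1) (L i f) = -L (i + 2) f)
    (hS : ∀ f, 1 / 2 * B (∑ i, L i (L i f)) (∑ i, L i (L i f)) + ∑ i, B (L i f) (L i f)
      ≤ ∑ i, ∑ j, B (L i (L j f)) (L i (L j f))) (f : V) :
    25 / 36 * (B (E f) (E f) + ∑ i, B (L i f) (L i f)) ≤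
      B (E (E f) + E f + ∑ i, L i (L i f)) (E (E f) + E f + ∑ i, L i (L i f)) := by
  have hcomm (j : Fin 3) : ∑ i, L i (L i (L j f)) = L j (∑ i, L i (L i f)) := by
    have h0 := fun f ↦ hLL 0 f
    have h1 := fun f ↦ hLL 1 f
    have h2 := fun f ↦ hLL 2 f
    simp only [Fin.isValue, zero_add, Fin.reduceAdd] at h0 h1 h2
    have a0 := fun f ↦ sub_eq_iff_eq_add.1 (h0 f)
    have a1 := fun f ↦ sub_eq_iff_eq_add.1 (h1 f)
    have a2 := fun f ↦ sub_eq_iff_eq_add.1 (h2 f)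
    fin_cases j <;> simp [Fin.sum_univ_three, a0, a1, a2] <;> abel
  set Λ := ∑ i, L i (L i f) with hΛ
  have hd : ∑ i, ∑ j, B (L i (L j f)) (L i (L j f)) = B Λ Λ := by
    rw [Finset.sum_comm]
    calc ∑ j, ∑ i, B (L i (L j f)) (L i (L j f))
        = ∑ j, -B (L j f) (∑ i, L i (L i (L j f))) := by
          refine Finset.sum_congr rfl fun j _ ↦ ?_
          simp only [map_sum, ← Finset.sum_neg_distrib]
          exact Finset.sum_congr rfl fun i _ ↦ hL i _ _
      _ = ∑ j, B (L j (L j f)) Λ := by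
          refine Finset.sum_congr rfl fun j _ ↦ ?_
          rw [hcomm, hL j (L j f)]
      _ = B Λ Λ := by
          have : B (∑ j, L j (L j f)) Λ = ∑ j, B (L j (L j f)) Λ := by
            rw [map_sum B, LinearMap.sum_apply]
          exact this.symm
  have hS' := hS f
  rw [hd, ← hΛ] at hS'
  have hfΛ : B f Λ = -∑ i, B (L i f) (L i f) := by
    rw [hΛ, map_sum, ← Finset.sum_neg_distrib]
    exact Finset.sum_congr rfl fun i _ ↦ by rw [hL, neg_neg]
  have hEskew (g : V) : B (E g) g = 1 / 2 * B g g := by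
    have := hE g g
    rw [hsymm g (E g)] at this
    linarith
  have hEΛ : B (E f) Λ = -(1 / 2) * ∑ i, B (L i f) (L i f) := by
    rw [hΛ, map_sum, Finset.mul_sum]
    refine Finset.sum_congr rfl fun i _ ↦ ?_
    have h1 := hL i (E f) (L i f)
    have h2 := hEskew (L i f)
    rw [hLE] at h1
    linarith
  have hLnonneg : 0 ≤ ∑ i, B (E (L i f) - (1 / 2 : ℝ) • L i f) (E (L i f) - (1 / 2 : ℝ) • L i f) :=
    Finset.sum_nonneg fun i _ ↦ hnonneg _
  have hEELnonneg : ∑ i, B (E (L i f) - (1 / 2 : ℝ) • L i f) (E (L i f) - (1 / 2 : ℝ) • L i f)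
      = ∑ i, B (E (L i f)) (E (L i f)) - 1 / 4 * ∑ i, B (L i f) (L i f) := by
    rw [Finset.mul_sum, ← Finset.sum_sub_distrib]
    refine Finset.sum_congr rfl fun i _ ↦ ?_
    have := hEskew (L i f)
    simp only [map_sub, map_smul, LinearMap.sub_apply, LinearMap.smul_apply, smul_eq_mul]
    rw [hsymm (L i f) (E (L i f))]
    linarith
  have hEEΛ : B (E (E f)) Λ = ∑ i, B (E (L i f)) (E (L i f)) - 1 / 2 * ∑ i, B (L i f) (L i f) := by
    rw [hΛ, map_sum, Finset.mul_sum, ← Finset.sum_sub_distrib]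
    refine Finset.sum_congr rfl fun i _ ↦ ?_
    have h1 := hL i (E (E f)) (L i f)
    rw [hLE, hLE] at h1
    have h2 := hE (E (L i f)) (L i f)
    have h3 := hEskew (L i f)
    linarith
  have h1 := hEskew f
  have h2 := hEskew (E f)
  have h3 := hE (E f) f
  have h4 := hnonneg (E (E f) - E f + (1 / 4 : ℝ) • f)
  have h5 := hnonneg (E f - (1 / 2 : ℝ) • f)
  have h6 := hnonneg (Λ + (2 : ℝ) • f)
  have s1 := hsymm Λ (E f)
  have s2 := hsymm Λ (E (E f))
  have s3 := hsymm Λ f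
  have s4 := hsymm f (E f)
  have s5 := hsymm f (E (E f))
  have s6 := hsymm (E f) (E (E f))
  simp only [map_add, map_sub, map_smul, LinearMap.add_apply, LinearMap.sub_apply,
    LinearMap.smul_apply, smul_eq_mul] at h4 h5 h6 ⊢
  linarith

/-- Three-dimensional Euclidean space. -/
abbrev E3 : Type := EuclideanSpace ℝ (Fin 3)

/-- The punctured space. -/
def punctured : TopologicalSpace.Opens E3 := ⟨{0}ᶜ, isOpen_compl_singleton⟩

/-- Smooth functions with compact support away from the origin. -/
abbrev Test : Type := TestFunction punctured ℝ ⊤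

theorem Test.zero_notMem (f : Test) : (0 : E3) ∉ tsupport f :=
  fun h ↦ f.tsupport_subset h rfl

theorem Test.contDiff_top (f : Test) : ContDiff ℝ ∞ f := f.contDiff

theorem Test.contDiff_two (f : Test) : ContDiff ℝ 2 f :=
  contDiff_infty.1 f.contDiff_top 2

theorem Test.differentiable (f : Test) : Differentiable ℝ f :=
  f.contDiff_top.differentiable (by simp)

theorem Test.contDiff_fderiv (f : Test) : ContDiff ℝ ∞ (fderiv ℝ f) :=
  f.contDiff_top.fderiv_right (m := ∞) (by simp)

/-- Differentiation along the linear vector field `x ↦ A x`. -/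
noncomputable def along (A : E3 →L[ℝ] E3) : Test →ₗ[ℝ] Test where
  toFun f :=
    { toFun := fun x ↦ fderiv ℝ f x (A x)
      contDiff' := f.contDiff_fderiv.clm_apply A.contDiff
      hasCompactSupport' := (f.hasCompactSupport.fderiv ℝ).mono
        fun x (hx : fderiv ℝ f x (A x) ≠ 0) (h : fderiv ℝ f x = 0) ↦ hx (by simp [h])
      tsupport_subset' := ((closure_mono fun x (hx : fderiv ℝ f x (A x) ≠ 0)
        (h : fderiv ℝ f x = 0) ↦ hx (by simp [h])).trans (tsupport_fderiv_subset ℝ)).trans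
        f.tsupport_subset }
  map_add' f g := by
    ext x
    change fderiv ℝ (⇑f + ⇑g) x (A x) = fderiv ℝ f x (A x) + fderiv ℝ g x (A x)
    rw [fderiv_add f.differentiable.differentiableAt g.differentiable.differentiableAt]
    rfl
  map_smul' c f := by
    ext x
    change fderiv ℝ (c • ⇑f) x (A x) = c • fderiv ℝ f x (A x)
    rw [fderiv_const_smul f.differentiable.differentiableAt]
    rfl

theorem along_apply (A : E3 →L[ℝ] E3) (f : Test) (x : E3) :
    along A f x = fderiv ℝ f x (A x) := rfl

theorem along_along_apply (A A' : E3 →L[ℝ] E3) (f : Test) (x : E3) :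
    along A (along A' f) x =
      fderiv ℝ (fderiv ℝ f) x (A x) (A' x) + fderiv ℝ f x (A' (A x)) := by
  have h : HasFDerivAt (fun x ↦ fderiv ℝ f x (A' x)) _ x :=
    ((f.contDiff_fderiv.differentiable (by simp)) x).hasFDerivAt.clm_apply A'.hasFDerivAt
  change fderiv ℝ (fun x ↦ fderiv ℝ f x (A' x)) x (A x) = _
  rw [h.fderiv]
  simp [add_comm]

theorem fderiv_fderiv_symm {f : E3 → ℝ} (hf : ContDiff ℝ 2 f) (x y z : E3) :
    fderiv ℝ (fderiv ℝ f) x y z = fderiv ℝ (fderiv ℝ f) x z y :=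
  (hf.contDiffAt.isSymmSndFDerivAt (by simp)) y z

/-- Infinitesimal rotation about the `k`-th coordinate axis. -/
noncomputable def rot (k : Fin 3) : E3 →L[ℝ] E3 :=
  (EuclideanSpace.proj (𝕜 := ℝ) (k + 1)).smulRight (EuclideanSpace.single (k + 2) (1 : ℝ)) -
    (EuclideanSpace.proj (𝕜 := ℝ) (k + 2)).smulRight (EuclideanSpace.single (k + 1) (1 : ℝ))

theorem rot_apply (k : Fin 3) (x : E3) :
    rot k x = x (k + 1) • EuclideanSpace.single (k + 2) (1 : ℝ) -
      x (k + 2) • EuclideanSpace.single (k + 1) (1 : ℝ) := rfl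

theorem eq_sum_single (x : E3) : x = x 0 • EuclideanSpace.single 0 (1 : ℝ) +
    x 1 • EuclideanSpace.single 1 (1 : ℝ) + x 2 • EuclideanSpace.single 2 (1 : ℝ) := by
  ext i
  fin_cases i <;> simp

theorem norm_sq_eq_coord (x : E3) : ‖x‖ ^ 2 = x 0 ^ 2 + x 1 ^ 2 + x 2 ^ 2 := by
  simp [EuclideanSpace.norm_sq_eq, Fin.sum_univ_three]

theorem along_rot_euler (i : Fin 3) (f : Test) :
    along (rot i) (along (.id ℝ E3) f) = along (.id ℝ E3) (along (rot i) f) := by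
  ext x
  rw [along_along_apply, along_along_apply, fderiv_fderiv_symm f.contDiff_two]
  simp

theorem along_rot_commutator (i : Fin 3) (f : Test) :
    along (rot i) (along (rot (i + 1)) f) - along (rot (i + 1)) (along (rot i) f) =
      -along (rot (i + 2)) f := by
  ext x
  change along (rot i) (along (rot (i + 1)) f) x - along (rot (i + 1)) (along (rot i) f) x =
      -along (rot (i + 2)) f x
  rw [along_along_apply, along_along_apply, fderiv_fderiv_symm f.contDiff_two,
    add_sub_add_left_eq_sub, along_apply, ← map_sub, ← map_neg]
  congr 1
  ext j
  fin_cases i <;> fin_cases j <;> simp [rot_apply]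

theorem sphere_pointwise {x l : Fin 3 → ℝ} {N : Fin 3 → Fin 3 → ℝ} (hx : 0 < ∑ i, x i ^ 2)
    (hl : ∑ i, x i * l i = 0) (hN : ∀ j, ∑ i, x i * N i j = 0)
    (hNx : ∀ i, ∑ j, N i j * x j = x (i + 2) * l (i + 1) - x (i + 1) * l (i + 2)) :
    1 / 2 * (∑ i, N i i) ^ 2 + ∑ i, l i ^ 2 ≤ ∑ i, ∑ j, N i j ^ 2 := by
  set r := ∑ i, x i ^ 2 with hr
  set t := ∑ i, N i i with ht
  set w : Fin 3 → ℝ := fun i ↦ ∑ j, N i j * x j with hw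
  have hwx : ∑ i, w i * x i = 0 := by
    have h0 := hN 0
    have h1 := hN 1
    have h2 := hN 2
    simp only [hw, Fin.sum_univ_three] at h0 h1 h2 ⊢
    linear_combination x 0 * h0 + x 1 * h1 + x 2 * h2
  have hww : ∑ i, w i ^ 2 = r * ∑ i, l i ^ 2 := by
    simp only [hw, hNx]
    simp only [hr, Fin.sum_univ_three, Fin.isValue, zero_add, Fin.reduceAdd] at hl ⊢
    linear_combination -(x 0 * l 0 + x 1 * l 1 + x 2 * l 2) * hl
  have hsq : 0 ≤ ∑ i, ∑ j,
      (r * N i j - w i * x j - t / 2 * (r * (if i = j then 1 else 0) - x i * x j)) ^ 2 := by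
    positivity
  have hexp : ∑ i, ∑ j,
      (r * N i j - w i * x j - t / 2 * (r * (if i = j then 1 else 0) - x i * x j)) ^ 2 =
      r ^ 2 * (∑ i, ∑ j, N i j ^ 2 - 1 / 2 * t ^ 2) - r * ∑ i, w i ^ 2
        + t * r * ∑ i, w i * x i := by
    simp only [hr, ht, hw, Fin.sum_univ_three, Fin.isValue, Fin.reduceEq, if_true, if_false]
    ring
  rw [hexp, hwx, hww] at hsq
  have : 0 ≤ r ^ 2 * (∑ i, ∑ j, N i j ^ 2 - 1 / 2 * t ^ 2 - ∑ i, l i ^ 2) := by linarith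
  linarith [nonneg_of_mul_nonneg_right this (by positivity)]

theorem along_rot_pointwise (f : Test) {x : E3} (hx : x ≠ 0) :
    1 / 2 * (∑ i, along (rot i) (along (rot i) f) x) ^ 2 + ∑ i, along (rot i) f x ^ 2 ≤
      ∑ i, ∑ j, along (rot i) (along (rot j) f) x ^ 2 := by
  have hxx : ∑ i, x i • rot i x = 0 := by
    ext j
    fin_cases j <;> simp [rot_apply, Fin.sum_univ_three] <;> ring
  have hsum (g : Test) : ∑ i, x i * along (rot i) g x = 0 := by
    have := congrArg (fderiv ℝ g x) hxx
    simpa [along_apply] using this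
  refine sphere_pointwise (x := x) (l := fun i ↦ along (rot i) f x)
    (N := fun i j ↦ along (rot i) (along (rot j) f) x) ?_ (hsum f) (fun j ↦ hsum _) fun i ↦ ?_
  · rw [← EuclideanSpace.real_norm_sq_eq]
    positivity
  · have h1 := congrArg (fderiv ℝ (fderiv ℝ f) x (rot i x)) hxx
    have h2 : ∑ j, x j • rot j (rot i x) =
        x (i + 2) • rot (i + 1) x - x (i + 1) • rot (i + 2) x := by
      ext j
      fin_cases i <;> fin_cases j <;> simp [rot_apply, Fin.sum_univ_three] <;> ring
    have h2' := congrArg (fderiv ℝ f x) h2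
    simp only [map_sum, map_smul, smul_eq_mul, map_zero, map_sub] at h1 h2'
    simp only [along_along_apply]
    simp only [along_apply, mul_add, Finset.sum_add_distrib,
      mul_comm _ (x _)]
    rw [h1, h2', zero_add]

/-- The weight `|x|⁻⁴`. -/
noncomputable def weight (x : E3) : ℝ := (‖x‖ ^ 2)⁻¹ ^ 2

theorem weight_nonneg (x : E3) : 0 ≤ weight x := by
  unfold weight; positivity

theorem hasFDerivAt_weight {x : E3} (hx : x ≠ 0) :
    HasFDerivAt weight ((-4 * (‖x‖ ^ 2)⁻¹ ^ 3) • innerSL ℝ x) x := by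
  have h := ((hasDerivAt_inv (x := ‖x‖ ^ 2) (by positivity)).comp_hasFDerivAt x
    (hasStrictFDerivAt_norm_sq x).hasFDerivAt).pow 2
  refine h.congr_fderiv ?_
  ext y
  simp
  ring

theorem contDiffAt_weight {x : E3} (hx : x ≠ 0) : ContDiffAt ℝ ∞ weight x :=
  (((contDiff_norm_sq ℝ).contDiffAt).inv (by positivity)).pow 2

theorem contDiff_mul_of_zero_notMem {n : ℕ∞ω} {φ h : E3 → ℝ}
    (hφ : ∀ x ≠ 0, ContDiffAt ℝ n φ x) (hh : ContDiff ℝ n h) (h0 : (0 : E3) ∉ tsupport h) :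
    ContDiff ℝ n (fun x ↦ φ x * h x) := by
  refine contDiff_iff_contDiffAt.2 fun x ↦ ?_
  by_cases hx : x ∈ tsupport h
  · exact (hφ x fun h ↦ h0 (h ▸ hx)).mul hh.contDiffAt
  · refine contDiffAt_const (c := (0 : ℝ)) |>.congr_of_eventuallyEq ?_
    filter_upwards [notMem_tsupport_iff_eventuallyEq.1 hx] with y hy
    simp [hy]

theorem contDiff_weight_mul {n : ℕ∞} {h : E3 → ℝ} (hh : ContDiff ℝ n h)
    (h0 : (0 : E3) ∉ tsupport h) : ContDiff ℝ n (fun x ↦ weight x * h x) :=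
  contDiff_mul_of_zero_notMem (fun _ hx ↦ (contDiffAt_weight hx).of_le (mod_cast le_top)) hh h0

theorem integrable_weight_mul {h : E3 → ℝ} (hh : Continuous h) (hc : HasCompactSupport h)
    (h0 : (0 : E3) ∉ tsupport h) : Integrable (fun x ↦ weight x * h x) :=
  (contDiff_weight_mul (contDiff_zero.2 hh) h0).continuous.integrable_of_hasCompactSupport
    hc.mul_left

theorem integral_fderiv_linear (A : E3 →L[ℝ] E3) {h : E3 → ℝ} (hh : ContDiff ℝ 1 h)
    (hc : HasCompactSupport h) :
    ∫ x, fderiv ℝ h x (A x) = -(∑ i, A (EuclideanSpace.single i 1) i) * ∫ x, h x := by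
  have hcoord (i : Fin 3) (x : E3) :
      HasFDerivAt (fun x ↦ A x i) ((EuclideanSpace.proj (𝕜 := ℝ) i).comp A) x :=
    ((EuclideanSpace.proj (𝕜 := ℝ) i).comp A).hasFDerivAt
  have hcont (i : Fin 3) : Continuous fun x ↦ A x i :=
    ((EuclideanSpace.proj (𝕜 := ℝ) i).comp A).continuous
  have hcd (i : Fin 3) : Continuous fun x ↦ fderiv ℝ h x (EuclideanSpace.single i 1) :=
    (hh.continuous_fderiv (by simp)).clm_apply continuous_const
  have hint (i : Fin 3) :
      Integrable fun x ↦ A x i * fderiv ℝ h x (EuclideanSpace.single i 1) :=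
    ((hcont i).mul (hcd i)).integrable_of_hasCompactSupport
      (hc.fderiv_apply ℝ _).mul_left
  have hpart (i : Fin 3) : ∫ x, A x i * fderiv ℝ h x (EuclideanSpace.single i 1) =
      -(A (EuclideanSpace.single i 1) i) * ∫ x, h x := by
    have hfd (x : E3) : fderiv ℝ (fun x ↦ A x i) x (EuclideanSpace.single i 1) =
        A (EuclideanSpace.single i 1) i := by rw [(hcoord i x).fderiv]; rfl
    rw [integral_mul_fderiv_eq_neg_fderiv_mul_of_integrable]
    · simp only [hfd, integral_const_mul, neg_mul]
    · simp only [hfd]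
      exact (hh.continuous.integrable_of_hasCompactSupport hc).const_mul _
    · exact hint i
    · exact ((hcont i).mul hh.continuous).integrable_of_hasCompactSupport hc.mul_left
    · exact fun x _ ↦ (hcoord i x).differentiableAt
    · exact fun x _ ↦ (hh.differentiable (by simp)) x
  have hsum (x : E3) : fderiv ℝ h x (A x) =
      ∑ i, A x i * fderiv ℝ h x (EuclideanSpace.single i 1) := by
    conv_lhs => rw [eq_sum_single (A x)]
    simp [Fin.sum_univ_three]
  simp only [hsum]
  rw [integral_finsetSum _ fun i _ ↦ hint i]
  simp only [hpart, neg_mul, Finset.sum_neg_distrib, Finset.sum_mul]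

theorem integral_weight_fderiv (A : E3 →L[ℝ] E3) {c : ℝ}
    (hA : ∀ x, inner ℝ x (A x) = c * ‖x‖ ^ 2) {h : E3 → ℝ} (hh : ContDiff ℝ 1 h)
    (hc : HasCompactSupport h) (h0 : (0 : E3) ∉ tsupport h) :
    ∫ x, weight x * fderiv ℝ h x (A x) =
      (4 * c - ∑ i, A (EuclideanSpace.single i 1) i) * ∫ x, weight x * h x := by
  have hk := integral_fderiv_linear A (contDiff_weight_mul (n := 1) hh h0)
    (hc.mul_left (f := weight))
  have hpt (x : E3) : fderiv ℝ (fun x ↦ weight x * h x) x (A x) =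
      weight x * fderiv ℝ h x (A x) - 4 * c * (weight x * h x) := by
    by_cases hx : x = 0
    · subst hx
      simp [image_eq_zero_of_notMem_tsupport h0]
    · rw [((hasFDerivAt_weight hx).fun_mul ((hh.differentiable (by simp)) x).hasFDerivAt).fderiv]
      have hx' : ‖x‖ ≠ 0 := by simpa using hx
      simp only [add_apply, smul_apply,
        innerSL_apply_apply, hA, smul_eq_mul, weight]
      field_simp
      ring
  simp only [hpt] at hk
  have hi : Integrable fun x ↦ weight x * fderiv ℝ h x (A x) := by
    refine integrable_weight_mul ((hh.continuous_fderiv (by simp)).clm_apply A.continuous) ?_ ?_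
    · exact (hc.fderiv ℝ).mono
        fun x (hx : fderiv ℝ h x (A x) ≠ 0) (h : fderiv ℝ h x = 0) ↦ hx (by simp [h])
    · exact fun hx ↦ h0 (tsupport_fderiv_subset ℝ (closure_mono
        (fun x (hx : fderiv ℝ h x (A x) ≠ 0) (h : fderiv ℝ h x = 0) ↦ hx (by simp [h])) hx))
  rw [integral_sub hi ((integrable_weight_mul hh.continuous hc h0).const_mul _),
    integral_const_mul] at hk
  linarith

theorem Test.integrable (f g : Test) : Integrable (fun x ↦ weight x * (f x * g x)) :=
  integrable_weight_mul (f.continuous.mul g.continuous) f.hasCompactSupport.mul_right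
    fun h ↦ f.zero_notMem (tsupport_mul_subset_left h)

/-- The inner product of `L²(|x|⁻⁴ dx)` on test functions. -/
noncomputable def form : Test →ₗ[ℝ] Test →ₗ[ℝ] ℝ :=
  LinearMap.mk₂ ℝ (fun f g ↦ ∫ x, weight x * (f x * g x))
    (fun f g h ↦ by
      rw [← integral_add (f.integrable h) (g.integrable h)]
      exact integral_congr_ae (.of_forall fun x ↦ by simp [add_mul, mul_add]))
    (fun c f g ↦ by
      rw [smul_eq_mul, ← integral_const_mul]
      exact integral_congr_ae (.of_forall fun x ↦ by simp; ring))
    (fun f g h ↦ by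
      rw [← integral_add (f.integrable g) (f.integrable h)]
      exact integral_congr_ae (.of_forall fun x ↦ by simp [mul_add]))
    (fun c f g ↦ by
      rw [smul_eq_mul, ← integral_const_mul]
      exact integral_congr_ae (.of_forall fun x ↦ by simp; ring))

theorem form_apply (f g : Test) : form f g = ∫ x, weight x * (f x * g x) := rfl

theorem form_along (A : E3 →L[ℝ] E3) {c : ℝ} (hA : ∀ x, inner ℝ x (A x) = c * ‖x‖ ^ 2)
    (f g : Test) : form (along A f) g =
      (4 * c - ∑ i, A (EuclideanSpace.single i 1) i) * form f g - form f (along A g) := by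
  have h := integral_weight_fderiv A hA (h := fun x ↦ f x * g x)
    ((contDiff_infty.1 f.contDiff_top 1).mul (contDiff_infty.1 g.contDiff_top 1))
    f.hasCompactSupport.mul_right fun h ↦ f.zero_notMem (tsupport_mul_subset_left h)
  rw [form_apply, form_apply, form_apply, ← h, eq_sub_iff_add_eq,
    ← integral_add ((along A f).integrable g) (f.integrable (along A g))]
  refine integral_congr_ae (.of_forall fun x ↦ ?_)
  simp only [along_apply]
  rw [fderiv_fun_mul f.differentiable.differentiableAt g.differentiable.differentiableAt]
  simp
  ring

theorem form_sphere (f : Test) :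
    1 / 2 * form (∑ i, along (rot i) (along (rot i) f)) (∑ i, along (rot i) (along (rot i) f))
      + ∑ i, form (along (rot i) f) (along (rot i) f) ≤
    ∑ i, ∑ j, form (along (rot i) (along (rot j) f)) (along (rot i) (along (rot j) f)) := by
  simp only [form_apply]
  rw [← integral_const_mul, ← integral_finsetSum _ fun i _ ↦ Test.integrable _ _,
    ← integral_add ((Test.integrable _ _).const_mul _)
      (integrable_finsetSum _ fun i _ ↦ Test.integrable _ _)]
  simp_rw [← integral_finsetSum _ fun i _ ↦ Test.integrable _ _]
  rw [← integral_finsetSum _ fun i _ ↦ integrable_finsetSum _ fun i _ ↦ Test.integrable _ _]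
  refine integral_mono_ae (((Test.integrable _ _).const_mul _).add
    (integrable_finsetSum _ fun i _ ↦ Test.integrable _ _))
    (integrable_finsetSum _ fun i _ ↦ integrable_finsetSum _ fun i _ ↦ Test.integrable _ _) ?_
  filter_upwards [compl_mem_ae_iff.2 (measure_singleton (0 : E3))] with x hx
  have h := mul_le_mul_of_nonneg_left (along_rot_pointwise f hx) (weight_nonneg x)
  simp only [← pow_two, FunLike.coe_sum, Finset.sum_apply, ← Finset.mul_sum] at h ⊢
  linarith

theorem inner_rot_self (j : Fin 3) (x : E3) : inner ℝ x (rot j x) = 0 := by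
  fin_cases j <;> simp [rot_apply, PiLp.inner_apply, Fin.sum_univ_three] <;> ring

theorem form_rot (i : Fin 3) (f g : Test) :
    form (along (rot i) f) g = -form f (along (rot i) g) := by
  rw [form_along (rot i) (c := 0) (fun x ↦ by simp [inner_rot_self])]
  fin_cases i <;> simp [Fin.sum_univ_three, rot_apply]

theorem smooth_form_ineq (f : Test) :
    25 / 36 * (form (along (.id ℝ E3) f) (along (.id ℝ E3) f)
      + ∑ i, form (along (rot i) f) (along (rot i) f)) ≤
    form (along (.id ℝ E3) (along (.id ℝ E3) f) + along (.id ℝ E3) f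
        + ∑ i, along (rot i) (along (rot i) f))
      (along (.id ℝ E3) (along (.id ℝ E3) f) + along (.id ℝ E3) f
        + ∑ i, along (rot i) (along (rot i) f)) := by
  refine le_of_skew form (along (.id ℝ E3)) (fun i ↦ along (rot i)) ?_ ?_ ?_ ?_ along_rot_euler
    along_rot_commutator form_sphere f
  · intro f g
    simp only [form_apply, mul_comm]
  · intro f
    rw [form_apply]
    exact integral_nonneg fun x ↦ mul_nonneg (weight_nonneg x) (mul_self_nonneg _)
  · intro f g
    rw [form_along (.id ℝ E3) (c := 1) (fun x ↦ by simp)]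
    norm_num [Fin.sum_univ_three]
  · exact form_rot

theorem lap_eq (u : E3 → ℝ) (x : E3) : lap u x = ∑ i, fderiv ℝ (fderiv ℝ u) x
    (EuclideanSpace.single i 1) (EuclideanSpace.single i 1) := by
  simp [lap, iteratedFDeriv_two_apply]

theorem norm_gradient_sq (u : E3 → ℝ) (x : E3) :
    ‖gradient u x‖ ^ 2 = ∑ i, fderiv ℝ u x (EuclideanSpace.single i 1) ^ 2 := by
  rw [EuclideanSpace.real_norm_sq_eq]
  refine Finset.sum_congr rfl fun i _ ↦ ?_
  have h : inner ℝ (gradient u x) (EuclideanSpace.single i 1) =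
      fderiv ℝ u x (EuclideanSpace.single i 1) := by
    rw [gradient, InnerProductSpace.toDual_symm_apply]
  rw [← h, EuclideanSpace.inner_single_right]
  simp

theorem apply_eq_coord (T : E3 →L[ℝ] ℝ) (x : E3) :
    T x = ∑ i, x i * T (EuclideanSpace.single i 1) := by
  have h := congrArg T (eq_sum_single x)
  simp only [map_add, map_smul, smul_eq_mul] at h
  rw [h, Fin.sum_univ_three]

theorem apply_apply_eq_coord (T : E3 →L[ℝ] E3 →L[ℝ] ℝ) (x y : E3) :
    T x y = ∑ i, ∑ j, x i * (y j * T (EuclideanSpace.single i 1) (EuclideanSpace.single j 1)) := by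
  rw [← ContinuousLinearMap.flip_apply, apply_eq_coord (T.flip y)]
  simp only [ContinuousLinearMap.flip_apply, apply_eq_coord _ y, Finset.mul_sum]

theorem norm_sq_mul_norm_gradient_sq (u : E3 → ℝ) (x : E3) :
    ‖x‖ ^ 2 * ‖gradient u x‖ ^ 2 = fderiv ℝ u x x ^ 2 + ∑ i, fderiv ℝ u x (rot i x) ^ 2 := by
  rw [norm_gradient_sq, norm_sq_eq_coord, apply_eq_coord _ x]
  simp only [Fin.sum_univ_three, rot_apply, map_sub, map_smul, smul_eq_mul, Fin.isValue, zero_add,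
    Fin.reduceAdd]
  ring

theorem sum_rot_rot (x : E3) : ∑ i, rot i (rot i x) = (-2 : ℝ) • x := by
  ext j
  fin_cases j <;> simp [rot_apply, Fin.sum_univ_three] <;> ring

theorem norm_sq_mul_trace (T : E3 →L[ℝ] E3 →L[ℝ] ℝ) (hT : ∀ x y, T x y = T y x) (x : E3) :
    ‖x‖ ^ 2 * ∑ i, T (EuclideanSpace.single i 1) (EuclideanSpace.single i 1) =
      T x x + ∑ i, T (rot i x) (rot i x) := by
  have s1 := hT (EuclideanSpace.single 1 1) (EuclideanSpace.single 0 1)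
  have s2 := hT (EuclideanSpace.single 2 1) (EuclideanSpace.single 0 1)
  have s3 := hT (EuclideanSpace.single 2 1) (EuclideanSpace.single 1 1)
  rw [norm_sq_eq_coord, apply_apply_eq_coord T x x]
  simp only [Fin.sum_univ_three, rot_apply, map_sub, map_smul, sub_apply, smul_apply, smul_eq_mul,
    Fin.isValue, zero_add, Fin.reduceAdd, s1, s2, s3]
  ring

theorem norm_sq_mul_lap (f : Test) (x : E3) :
    ‖x‖ ^ 2 * lap f x = along (.id ℝ E3) (along (.id ℝ E3) f) x + along (.id ℝ E3) f x
      + ∑ i, along (rot i) (along (rot i) f) x := by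
  have h := congrArg (fderiv ℝ f x) (sum_rot_rot x)
  simp only [map_sum, map_smul, smul_eq_mul] at h
  rw [lap_eq, norm_sq_mul_trace _ (fderiv_fderiv_symm f.contDiff_two x)]
  simp only [along_along_apply, Finset.sum_add_distrib, h]
  simp only [along_apply, ContinuousLinearMap.id_apply]
  ring

theorem integral_lap_sq (f : Test) : ∫ x, lap f x ^ 2 =
    form (along (.id ℝ E3) (along (.id ℝ E3) f) + along (.id ℝ E3) f
        + ∑ i, along (rot i) (along (rot i) f))
      (along (.id ℝ E3) (along (.id ℝ E3) f) + along (.id ℝ E3) f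
        + ∑ i, along (rot i) (along (rot i) f)) := by
  rw [form_apply]
  refine integral_congr_ae ?_
  filter_upwards [compl_mem_ae_iff.2 (measure_singleton (0 : E3))] with x hx
  have hx' : ‖x‖ ≠ 0 := by simpa using hx
  simp only [FunLike.coe_add, FunLike.coe_sum, Pi.add_apply, Finset.sum_apply]
  rw [← norm_sq_mul_lap, weight]
  field_simp

theorem rpow_neg_two_mul_gradient_eq (f : E3 → ℝ) {x : E3} (hx : x ≠ 0) :
    ‖x‖ ^ (-2 : ℝ) * ‖gradient f x‖ ^ 2 =
      weight x * (fderiv ℝ f x x ^ 2 + ∑ i, fderiv ℝ f x (rot i x) ^ 2) := by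
  have hx' : ‖x‖ ≠ 0 := by simpa using hx
  rw [← norm_sq_mul_norm_gradient_sq, weight, Real.rpow_neg (norm_nonneg x), Real.rpow_two]
  field_simp

theorem integral_gradient_sq (f : Test) : ∫ x : E3, ‖x‖ ^ (-2 : ℝ) * ‖gradient f x‖ ^ 2 =
    form (along (.id ℝ E3) f) (along (.id ℝ E3) f)
      + ∑ i, form (along (rot i) f) (along (rot i) f) := by
  simp only [form_apply]
  rw [← integral_finsetSum _ fun i _ ↦ Test.integrable _ _, ← integral_add (Test.integrable _ _)
    (integrable_finsetSum _ fun i _ ↦ Test.integrable _ _)]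
  refine integral_congr_ae ?_
  filter_upwards [compl_mem_ae_iff.2 (measure_singleton (0 : E3))] with x hx
  rw [rpow_neg_two_mul_gradient_eq _ hx, mul_add, Finset.mul_sum]
  simp only [along_apply, pow_two, ContinuousLinearMap.id_apply]

theorem smooth_ineq (f : Test) :
    25 / 36 * ∫ x : E3, ‖x‖ ^ (-2 : ℝ) * ‖gradient f x‖ ^ 2 ≤ ∫ x, lap f x ^ 2 := by
  rw [integral_lap_sq, integral_gradient_sq]
  exact smooth_form_ineq f

/-- Mollification by a normalized bump function. -/
noncomputable def mollify (φ : ContDiffBump (0 : E3)) (g : E3 → ℝ) : E3 → ℝ :=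
  convolution (φ.normed volume) g (ContinuousLinearMap.lsmul ℝ ℝ) volume

theorem fderiv_mollify (φ : ContDiffBump (0 : E3)) {g : E3 → ℝ} (hg : ContDiff ℝ 1 g)
    (hc : HasCompactSupport g) (x v : E3) :
    fderiv ℝ (mollify φ g) x v = mollify φ (fun y ↦ fderiv ℝ g y v) x := by
  have hφ : LocallyIntegrable (φ.normed volume) := φ.continuous_normed.locallyIntegrable
  have h := hc.hasFDerivAt_convolution_right (ContinuousLinearMap.lsmul ℝ ℝ) hφ hg x
  rw [mollify, h.fderiv, convolution_precompR_apply _ hφ (hc.fderiv ℝ)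
    (hg.continuous_fderiv (by simp))]
  rfl

theorem contDiff_mollify (φ : ContDiffBump (0 : E3)) {g : E3 → ℝ} (hg : Continuous g) :
    ContDiff ℝ ∞ (mollify φ g) :=
  φ.hasCompactSupport_normed.contDiff_convolution_left _ φ.contDiff_normed hg.locallyIntegrable

theorem hasCompactSupport_mollify (φ : ContDiffBump (0 : E3)) {g : E3 → ℝ}
    (hc : HasCompactSupport g) : HasCompactSupport (mollify φ g) :=
  φ.hasCompactSupport_normed.convolution _ hc

theorem mollify_eq_zero (φ : ContDiffBump (0 : E3)) {g : E3 → ℝ} (hg : Continuous g) {x : E3}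
    (hx : ∀ y ∈ Metric.ball x φ.rOut, g y = 0) : mollify φ g x = 0 := by
  have hx0 := hx x (Metric.mem_ball_self φ.rOut_pos)
  have h := φ.dist_normed_convolution_le (μ := volume) (x₀ := x) (ε := 0)
    hg.aestronglyMeasurable (fun y hy ↦ by rw [hx y hy, hx0, dist_self])
  rw [hx0] at h
  exact dist_le_zero.1 h

theorem abs_mollify_le (φ : ContDiffBump (0 : E3)) {g : E3 → ℝ} (hg : Continuous g) {M : ℝ}
    (hM : ∀ y, |g y| ≤ M) (x : E3) : |mollify φ g x| ≤ 3 * M := by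
  have h := φ.dist_normed_convolution_le (μ := volume) (x₀ := x) (ε := 2 * M)
    hg.aestronglyMeasurable (fun y _ ↦ by
      rw [Real.dist_eq]
      linarith [abs_sub (g y) (g x), hM y, hM x])
  change dist (mollify φ g x) (g x) ≤ 2 * M at h
  rw [Real.dist_eq] at h
  have := abs_sub_abs_le_abs_sub (mollify φ g x) (g x)
  linarith [hM x]

/-- Mollifications at scale below `δ / 2` of a function supported in an annulus are dominated by a
multiple of the indicator of a larger annulus. -/
theorem abs_mollify_le_indicator (φ : ContDiffBump (0 : E3)) {g : E3 → ℝ} (hg : Continuous g)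
    {M δ R : ℝ} (hM : ∀ y, |g y| ≤ M) (hδ : ∀ y, ‖y‖ < δ → g y = 0) (hR : ∀ y, R < ‖y‖ → g y = 0)
    (hφ : φ.rOut ≤ δ / 2) (x : E3) :
    |mollify φ g x| ≤ ((Metric.closedBall 0 (R + δ) \ Metric.ball 0 (δ / 2)).indicator
      (fun _ : E3 ↦ 3 * M)) x := by
  by_cases hx : x ∈ Metric.closedBall (0 : E3) (R + δ) \ Metric.ball 0 (δ / 2)
  · rw [indicator_of_mem hx]
    exact abs_mollify_le φ hg hM x
  · rw [indicator_of_notMem hx, mollify_eq_zero φ hg, abs_zero]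
    intro y hy
    rw [mem_ball_iff_norm] at hy
    have h1 := norm_sub_norm_le x y
    have h2 := norm_sub_norm_le y x
    rw [norm_sub_rev] at h1
    have h3 := φ.rOut_pos
    simp only [Set.mem_sdiff, Metric.mem_closedBall, Metric.mem_ball, dist_zero_right, not_and_or,
      not_le, not_not] at hx
    rcases hx with hx | hx
    · exact hR y (by linarith)
    · exact hδ y (by linarith)

theorem lap_eq_fderiv_partial {u : E3 → ℝ} (hu : ContDiff ℝ 2 u) (x : E3) : lap u x =
    ∑ i, fderiv ℝ (fun y ↦ fderiv ℝ u y (EuclideanSpace.single i 1)) x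
      (EuclideanSpace.single i 1) := by
  rw [lap_eq]
  refine Finset.sum_congr rfl fun i _ ↦ ?_
  have h : DifferentiableAt ℝ (fderiv ℝ u) x :=
    (hu.fderiv_right (m := 1) (by norm_num)).differentiable (by simp) x
  rw [fderiv_clm_apply h (differentiableAt_const _)]
  simp

/-- The inequality for functions of class `C²`, by mollification. -/
theorem rellich_ineq {u : E3 → ℝ} (hu : ContDiff ℝ 2 u) (hc : HasCompactSupport u)
    (h0 : (0 : E3) ∉ tsupport u) :
    25 / 36 * ∫ x : E3, ‖x‖ ^ (-2 : ℝ) * ‖gradient u x‖ ^ 2 ≤ ∫ x, lap u x ^ 2 := by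
  set p : Fin 3 → E3 → ℝ := fun i y ↦ fderiv ℝ u y (EuclideanSpace.single i 1) with hp
  set q : Fin 3 → E3 → ℝ := fun i y ↦ fderiv ℝ (p i) y (EuclideanSpace.single i 1) with hq
  have hpd (i : Fin 3) : ContDiff ℝ 1 (p i) :=
    (hu.fderiv_right (m := 1) (by norm_num)).clm_apply contDiff_const
  have hqd (i : Fin 3) : Continuous (q i) :=
    ((hpd i).continuous_fderiv (by simp)).clm_apply continuous_const
  have hpc (i : Fin 3) : HasCompactSupport (p i) := hc.fderiv_apply ℝ _
  have hqc (i : Fin 3) : HasCompactSupport (q i) := (hpc i).fderiv_apply ℝ _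
  have hps (i : Fin 3) : tsupport (p i) ⊆ tsupport u := tsupport_fderiv_apply_subset ℝ _
  have hqs (i : Fin 3) : tsupport (q i) ⊆ tsupport u :=
    (tsupport_fderiv_apply_subset ℝ _).trans (hps i)
  obtain ⟨δ, hδ, hδu⟩ := Metric.isOpen_iff.1 (isClosed_tsupport u).isOpen_compl 0 h0
  obtain ⟨R, hR⟩ := hc.isBounded.subset_closedBall 0
  have near {g : E3 → ℝ} (hg : tsupport g ⊆ tsupport u) (y : E3) (hy : ‖y‖ < δ) : g y = 0 :=
    image_eq_zero_of_notMem_tsupport fun h ↦ hδu (mem_ball_zero_iff.2 hy) (hg h)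
  have far {g : E3 → ℝ} (hg : tsupport g ⊆ tsupport u) (y : E3) (hy : R < ‖y‖) : g y = 0 :=
    image_eq_zero_of_notMem_tsupport fun h ↦
      hy.not_ge (mem_closedBall_zero_iff.1 (hR (hg h)))
  have hbdd {g : E3 → ℝ} (hg : Continuous g) (hgc : HasCompactSupport g) :
      ∃ M, ∀ y, |g y| ≤ M := hg.bounded_above_of_compact_support hgc
  choose Mp hMp using fun i ↦ hbdd (hpd i).continuous (hpc i)
  choose Mq hMq using fun i ↦ hbdd (hqd i) (hqc i)
  let φ (n : ℕ) : ContDiffBump (0 : E3) :=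
    { rIn := δ / 4 / (n + 1)
      rOut := δ / 2 / (n + 1)
      rIn_pos := by positivity
      rIn_lt_rOut := by gcongr; norm_num }
  have hφ (n : ℕ) : (φ n).rOut ≤ δ / 2 := div_le_self (by positivity) (by simp)
  have hφlim : Tendsto (fun n ↦ (φ n).rOut) atTop (𝓝 0) :=
    by simpa [φ, div_eq_mul_inv] using
      (tendsto_one_div_add_atTop_nhds_zero_nat (𝕜 := ℝ)).const_mul (δ / 2)
  have hlim {g : E3 → ℝ} (hg : Continuous g) (x : E3) :
      Tendsto (fun n ↦ mollify (φ n) g x) atTop (𝓝 (g x)) :=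
    ContDiffBump.convolution_tendsto_right_of_continuous hφlim hg x
  have hu0 (n : ℕ) : (0 : E3) ∉ tsupport (mollify (φ n) u) := by
    rw [notMem_tsupport_iff_eventuallyEq]
    filter_upwards [Metric.ball_mem_nhds (0 : E3) (half_pos hδ)] with x hx
    refine mollify_eq_zero (φ n) hu.continuous fun y hy ↦ near subset_rfl y ?_
    rw [mem_ball_iff_norm] at hy
    rw [mem_ball_zero_iff] at hx
    linarith [norm_sub_norm_le y x, hφ n]
  let U (n : ℕ) : Test :=
    { toFun := mollify (φ n) u
      contDiff' := contDiff_mollify (φ n) hu.continuous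
      hasCompactSupport' := hasCompactSupport_mollify (φ n) hc
      tsupport_subset' := fun x hx h ↦ hu0 n (h ▸ hx) }
  have hUp (n : ℕ) (i : Fin 3) :
      (fun x ↦ fderiv ℝ (U n) x (EuclideanSpace.single i 1)) = mollify (φ n) (p i) :=
    funext fun x ↦ fderiv_mollify (φ n) (hu.of_le (by norm_num)) hc x _
  have hUgrad (n : ℕ) (x : E3) : ‖gradient (U n) x‖ ^ 2 = ∑ i, mollify (φ n) (p i) x ^ 2 := by
    rw [norm_gradient_sq]
    exact Finset.sum_congr rfl fun i _ ↦ by rw [← hUp]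
  have hUlap (n : ℕ) (x : E3) : lap (U n) x = ∑ i, mollify (φ n) (q i) x := by
    rw [lap_eq_fderiv_partial (U n).contDiff_two]
    refine Finset.sum_congr rfl fun i _ ↦ ?_
    rw [hUp, fderiv_mollify (φ n) (hpd i) (hpc i)]
  let S := Metric.closedBall (0 : E3) (R + δ) \ Metric.ball 0 (δ / 2)
  have hSm : MeasurableSet S := measurableSet_closedBall.diff measurableSet_ball
  have hSf : volume S ≠ ⊤ := ((measure_mono sdiff_subset).trans_lt measure_closedBall_lt_top).ne
  have hbp (n : ℕ) (i : Fin 3) (x : E3) :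
      |mollify (φ n) (p i) x| ≤ S.indicator (fun _ ↦ 3 * Mp i) x :=
    abs_mollify_le_indicator (φ n) (hpd i).continuous (hMp i) (near (hps i)) (far (hps i)) (hφ n) x
  have hbq (n : ℕ) (i : Fin 3) (x : E3) :
      |mollify (φ n) (q i) x| ≤ S.indicator (fun _ ↦ 3 * Mq i) x :=
    abs_mollify_le_indicator (φ n) (hqd i) (hMq i) (near (hqs i)) (far (hqs i)) (hφ n) x
  have hL : Tendsto (fun n ↦ ∫ x, lap (U n) x ^ 2) atTop (𝓝 (∫ x, lap u x ^ 2)) := by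
    refine tendsto_integral_of_dominated_convergence
      (S.indicator fun _ ↦ (∑ i, 3 * Mq i) ^ 2) (fun n ↦ ?_) ?_ (fun n ↦ ?_) ?_
    · simp only [hUlap]
      exact ((continuous_finsetSum _ fun i _ ↦
        (contDiff_mollify (φ n) (hqd i)).continuous).pow 2).aestronglyMeasurable
    · exact (integrable_indicator_iff hSm).2 (integrableOn_const hSf)
    · refine .of_forall fun x ↦ ?_
      rw [hUlap, norm_pow, Real.norm_eq_abs]
      by_cases hx : x ∈ S
      · rw [indicator_of_mem hx]
        gcongr
        exact (Finset.abs_sum_le_sum_abs _ _).trans (Finset.sum_le_sum fun i _ ↦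
          (hbq n i x).trans_eq (indicator_of_mem hx _))
      · rw [indicator_of_notMem hx]
        have (i : Fin 3) : mollify (φ n) (q i) x = 0 :=
          abs_nonpos_iff.1 ((hbq n i x).trans_eq (indicator_of_notMem hx _))
        simp [this]
    · refine .of_forall fun x ↦ ?_
      simp only [hUlap, lap_eq_fderiv_partial hu]
      exact (tendsto_finsetSum _ fun i _ ↦ hlim (hqd i) x).pow 2
  have hG : Tendsto (fun n ↦ ∫ x : E3, ‖x‖ ^ (-2 : ℝ) * ‖gradient (U n) x‖ ^ 2) atTop
      (𝓝 (∫ x : E3, ‖x‖ ^ (-2 : ℝ) * ‖gradient u x‖ ^ 2)) := by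
    refine tendsto_integral_of_dominated_convergence
      (S.indicator fun _ ↦ (δ / 2) ^ (-2 : ℝ) * ∑ i, (3 * Mp i) ^ 2) (fun n ↦ ?_) ?_
      (fun n ↦ ?_) ?_
    · simp only [hUgrad]
      exact ((measurable_norm.pow_const _).aestronglyMeasurable).mul (continuous_finsetSum _
        fun i _ ↦
          (contDiff_mollify (φ n) (hpd i).continuous).continuous.pow 2).aestronglyMeasurable
    · exact (integrable_indicator_iff hSm).2 (integrableOn_const hSf)
    · refine .of_forall fun x ↦ ?_
      rw [hUgrad, Real.norm_of_nonneg (by positivity)]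
      by_cases hx : x ∈ S
      · rw [indicator_of_mem hx]
        have hx2 : δ / 2 ≤ ‖x‖ := by simpa using hx.2
        refine mul_le_mul (Real.rpow_le_rpow_of_nonpos (half_pos hδ) hx2 (by norm_num))
          (Finset.sum_le_sum fun i _ ↦ ?_) (by positivity) (by positivity)
        have h := (hbp n i x).trans_eq (indicator_of_mem hx _)
        exact sq_le_sq' (neg_le_of_abs_le h) (le_of_abs_le h)
      · rw [indicator_of_notMem hx]
        have (i : Fin 3) : mollify (φ n) (p i) x = 0 :=
          abs_nonpos_iff.1 ((hbp n i x).trans_eq (indicator_of_notMem hx _))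
        simp [this]
    · refine .of_forall fun x ↦ ?_
      simp only [hUgrad, norm_gradient_sq u]
      exact (tendsto_finsetSum _ fun i _ ↦ (hlim (hpd i).continuous x).pow 2).const_mul _
  exact le_of_tendsto_of_tendsto' (hG.const_mul _) hL fun n ↦ smooth_ineq (U n)

/-- The positive half-line. -/
def halfLine : TopologicalSpace.Opens ℝ := ⟨Ioi 0, isOpen_Ioi⟩

/-- Smooth radial profiles with compact support in the positive half-line. -/
abbrev Profile : Type := TestFunction halfLine ℝ ⊤

theorem Profile.eq_zero (ψ : Profile) {y : ℝ} (hy : y ≤ 0) : ψ y = 0 :=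
  image_eq_zero_of_notMem_tsupport fun h ↦ (ψ.tsupport_subset h : 0 < y).not_ge hy

theorem Profile.contDiff_top (ψ : Profile) : ContDiff ℝ ∞ ψ := ψ.contDiff

theorem Profile.differentiable (ψ : Profile) : Differentiable ℝ ψ :=
  ψ.contDiff_top.differentiable (by simp)

/-- The operator `y d/dy` on profiles. -/
noncomputable def theta : Profile →ₗ[ℝ] Profile where
  toFun ψ :=
    { toFun := fun y ↦ y * deriv ψ y
      contDiff' := contDiff_id.mul (contDiff_infty_iff_deriv.1 ψ.contDiff_top).2
      hasCompactSupport' := ψ.hasCompactSupport.deriv.mul_left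
      tsupport_subset' := (tsupport_mul_subset_right.trans tsupport_deriv_subset).trans
        ψ.tsupport_subset }
  map_add' ψ χ := by
    ext y
    change y * deriv (ψ + χ : ℝ → ℝ) y = y * deriv ψ y + y * deriv χ y
    rw [deriv_add (ψ.differentiable y) (χ.differentiable y), mul_add]
  map_smul' c ψ := by
    ext y
    change y * deriv (c • ψ : ℝ → ℝ) y = c * (y * deriv ψ y)
    rw [deriv_const_smul c (ψ.differentiable y), smul_eq_mul]
    ring

theorem theta_apply (ψ : Profile) (y : ℝ) : theta ψ y = y * deriv ψ y := rfl

theorem Profile.integrand_continuous (ψ χ : Profile) :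
    Continuous (fun y : ℝ ↦ y⁻¹ * (ψ y * χ y)) := by
  refine continuous_iff_continuousAt.2 fun y ↦ ?_
  by_cases hy : y ∈ tsupport ψ
  · have hy' : y ≠ 0 := (ψ.tsupport_subset hy : 0 < y).ne'
    exact (continuousAt_inv₀ hy').mul (ψ.continuous.mul χ.continuous).continuousAt
  · refine (continuousAt_const (y := (0 : ℝ))).congr ?_
    filter_upwards [notMem_tsupport_iff_eventuallyEq.1 hy] with z hz
    simp [hz]

theorem Profile.integrable (ψ χ : Profile) : Integrable (fun y : ℝ ↦ y⁻¹ * (ψ y * χ y)) :=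
  (ψ.integrand_continuous χ).integrable_of_hasCompactSupport
    ψ.hasCompactSupport.mul_right.mul_left

/-- The inner product of `L²(dy / y)` on profiles. -/
noncomputable def profileForm : Profile →ₗ[ℝ] Profile →ₗ[ℝ] ℝ :=
  LinearMap.mk₂ ℝ (fun f g ↦ ∫ y : ℝ, y⁻¹ * (f y * g y))
    (fun f g h ↦ by
      rw [← integral_add (f.integrable h) (g.integrable h)]
      exact integral_congr_ae (.of_forall fun x ↦ by simp [add_mul, mul_add]))
    (fun c f g ↦ by
      rw [smul_eq_mul, ← integral_const_mul]
      exact integral_congr_ae (.of_forall fun x ↦ by simp; ring))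
    (fun f g h ↦ by
      rw [← integral_add (f.integrable g) (f.integrable h)]
      exact integral_congr_ae (.of_forall fun x ↦ by simp [mul_add]))
    (fun c f g ↦ by
      rw [smul_eq_mul, ← integral_const_mul]
      exact integral_congr_ae (.of_forall fun x ↦ by simp; ring))

/-- The radial function `|x|^(-1/2) ψ(|x|^(2 * p))`. -/
noncomputable def radial (p : ℝ) (ψ : ℝ → ℝ) (x : E3) : ℝ :=
  (‖x‖ ^ 2) ^ (-(1 / 4) : ℝ) * ψ ((‖x‖ ^ 2) ^ p)

theorem radial_eq_zero_near {p : ℝ} (hp : 0 < p) (ψ : Profile) {x : E3}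
    (hx : (‖x‖ ^ 2) ^ p ∉ tsupport ψ) : radial p ψ =ᶠ[𝓝 x] 0 := by
  have hcont : Continuous fun x : E3 ↦ (‖x‖ ^ 2) ^ p :=
    (continuous_norm.pow 2).rpow_const fun _ ↦ .inr hp.le
  have h : ∀ᶠ z in 𝓝 x, (‖z‖ ^ 2) ^ p ∈ (tsupport ψ)ᶜ :=
    hcont.continuousAt.eventually ((isClosed_tsupport ψ).isOpen_compl.mem_nhds hx)
  filter_upwards [h] with z hz
  simp [radial, image_eq_zero_of_notMem_tsupport hz]

theorem ne_zero_of_mem_tsupport {p : ℝ} (hp : 0 < p) (ψ : Profile) {x : E3}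
    (hx : (‖x‖ ^ 2) ^ p ∈ tsupport ψ) : x ≠ 0 := by
  rintro rfl
  have : (0 : ℝ) < (‖(0 : E3)‖ ^ 2) ^ p := ψ.tsupport_subset hx
  simp [Real.zero_rpow hp.ne'] at this

theorem contDiff_radial {p : ℝ} (hp : 0 < p) (ψ : Profile) : ContDiff ℝ ∞ (radial p ψ) := by
  refine contDiff_iff_contDiffAt.2 fun x ↦ ?_
  by_cases hx : (‖x‖ ^ 2) ^ p ∈ tsupport ψ
  · have hx0 := ne_zero_of_mem_tsupport hp ψ hx
    have hpow (a : ℝ) : ContDiffAt ℝ ∞ (fun x : E3 ↦ (‖x‖ ^ 2) ^ a) x :=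
      (contDiff_norm_sq ℝ).contDiffAt.rpow_const_of_ne (by positivity)
    exact (hpow _).mul (ψ.contDiff_top.contDiffAt.comp x (hpow p))
  · exact contDiffAt_const.congr_of_eventuallyEq (radial_eq_zero_near hp ψ hx)

theorem mem_of_mem_tsupport_radial {p : ℝ} (hp : 0 < p) (ψ : Profile) {x : E3}
    (hx : x ∈ tsupport (radial p ψ)) : (‖x‖ ^ 2) ^ p ∈ tsupport ψ := by
  by_contra h
  exact notMem_tsupport_iff_eventuallyEq.2 (radial_eq_zero_near hp ψ h) hx

theorem hasCompactSupport_radial {p : ℝ} (hp : 0 < p) (ψ : Profile) :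
    HasCompactSupport (radial p ψ) := by
  obtain ⟨R, hR⟩ := ψ.hasCompactSupport.isBounded.subset_closedBall 0
  refine Metric.isCompact_of_isClosed_isBounded (isClosed_tsupport _)
    (isBounded_iff_forall_norm_le.2 ⟨max 1 (R ^ p⁻¹), fun x hx ↦ ?_⟩)
  have h := mem_of_mem_tsupport_radial hp ψ hx
  have h0 : 0 < (‖x‖ ^ 2) ^ p := ψ.tsupport_subset h
  have h1 : (‖x‖ ^ 2) ^ p ≤ R := (le_abs_self _).trans (mem_closedBall_zero_iff.1 (hR h))
  have h2 : ‖x‖ ^ 2 ≤ R ^ p⁻¹ := (Real.le_rpow_inv_iff_of_pos (by positivity)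
    (h0.le.trans h1) hp).2 h1
  rcases le_total ‖x‖ 1 with h3 | h3
  · exact h3.trans (le_max_left _ _)
  · exact ((le_self_pow₀ h3 two_ne_zero).trans h2).trans (le_max_right _ _)

/-- The test function `x_i |x|^(-1/2) ψ(|x|^(2 * p))`. -/
noncomputable def dipole {p : ℝ} (hp : 0 < p) (i : Fin 3) (ψ : Profile) : Test where
  toFun x := x i * radial p ψ x
  contDiff' := (EuclideanSpace.proj (𝕜 := ℝ) i).contDiff.mul (contDiff_radial hp ψ)
  hasCompactSupport' := (hasCompactSupport_radial hp ψ).mul_left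
  tsupport_subset' := fun _ hx ↦
    ne_zero_of_mem_tsupport hp ψ (mem_of_mem_tsupport_radial hp ψ (tsupport_mul_subset_right hx))

theorem dipole_apply {p : ℝ} (hp : 0 < p) (i : Fin 3) (ψ : Profile) (x : E3) :
    dipole hp i ψ x = x i * radial p ψ x := rfl

theorem dipole_add {p : ℝ} (hp : 0 < p) (i : Fin 3) (ψ χ : Profile) :
    dipole hp i (ψ + χ) = dipole hp i ψ + dipole hp i χ := by
  ext x
  simp [dipole_apply, radial, mul_add]

theorem dipole_smul {p : ℝ} (hp : 0 < p) (i : Fin 3) (c : ℝ) (ψ : Profile) :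
    dipole hp i (c • ψ) = c • dipole hp i ψ := by
  ext x
  simp [dipole_apply, radial]
  ring

theorem fderiv_radial {p : ℝ} (hp : 0 < p) (ψ : Profile) (x y : E3) :
    fderiv ℝ (radial p ψ) x y = 2 * (‖x‖ ^ 2)⁻¹ *
      (-(1 / 4) * radial p ψ x + p * radial p (theta ψ) x) * inner ℝ x y := by
  by_cases hx : x = 0
  · subst hx
    have h0 : (‖(0 : E3)‖ ^ 2) ^ p ∉ tsupport ψ := fun h ↦ ne_zero_of_mem_tsupport hp ψ h rfl
    rw [(radial_eq_zero_near hp ψ h0).fderiv_eq]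
    simp
  · have hs : 0 < ‖x‖ ^ 2 := by positivity
    have hn := (hasStrictFDerivAt_norm_sq x).hasFDerivAt
    have hpow (a : ℝ) := (Real.hasDerivAt_rpow_const (x := ‖x‖ ^ 2) (p := a)
      (.inl hs.ne')).comp_hasFDerivAt x hn
    have hψ := (ψ.differentiable ((‖x‖ ^ 2) ^ p)).hasDerivAt.comp_hasFDerivAt x (hpow p)
    have h : HasFDerivAt (radial p ψ) _ x := (hpow (-(1 / 4))).mul hψ
    rw [h.fderiv]
    simp only [radial, theta_apply, Function.comp_apply, add_apply, smul_apply, innerSL_apply_apply,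
      smul_eq_mul, nsmul_eq_mul, Real.rpow_sub_one hs.ne']
    field_simp
    push_cast
    ring

theorem along_dipole {p : ℝ} (hp : 0 < p) (i : Fin 3) (ψ : Profile) (A : E3 →L[ℝ] E3) (x : E3) :
    along A (dipole hp i ψ) x = A x i * radial p ψ x + x i * (2 * (‖x‖ ^ 2)⁻¹ *
      (-(1 / 4) * radial p ψ x + p * radial p (theta ψ) x) * inner ℝ x (A x)) := by
  have h : HasFDerivAt (fun x : E3 ↦ x i * radial p ψ x) _ x :=
    (EuclideanSpace.proj (𝕜 := ℝ) i).hasFDerivAt.mul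
    ((contDiff_radial hp ψ).differentiable (by simp) x).hasFDerivAt
  change fderiv ℝ (fun x : E3 ↦ x i * radial p ψ x) x (A x) = _
  rw [h.fderiv]
  simp only [add_apply, smul_apply, smul_eq_mul, fderiv_radial hp]
  simp
  ring

theorem euler_dipole {p : ℝ} (hp : 0 < p) (i : Fin 3) (ψ : Profile) :
    along (.id ℝ E3) (dipole hp i ψ) = dipole hp i ((1 / 2 : ℝ) • ψ + (2 * p) • theta ψ) := by
  ext x
  rw [along_dipole, dipole_add, dipole_smul, dipole_smul]
  simp only [FunLike.coe_add, FunLike.coe_smul, Pi.add_apply, Pi.smul_apply, smul_eq_mul,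
    dipole_apply, ContinuousLinearMap.id_apply, real_inner_self_eq_norm_sq]
  by_cases hx : x = 0
  · simp [hx]
  · have : ‖x‖ ≠ 0 := by simpa using hx
    field_simp
    ring

theorem rot_dipole {p : ℝ} (hp : 0 < p) (i j : Fin 3) (ψ : Profile) :
    along (rot j) (dipole hp i ψ) =
      ∑ k, rot j (EuclideanSpace.single k 1) i • dipole hp k ψ := by
  ext x
  rw [along_dipole, inner_rot_self]
  simp only [FunLike.coe_sum, FunLike.coe_smul, Finset.sum_apply, Pi.smul_apply, smul_eq_mul,
    dipole_apply]
  fin_cases i <;> fin_cases j <;> simp [rot_apply, Fin.sum_univ_three]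

theorem sum_rot_rot_dipole {p : ℝ} (hp : 0 < p) (i : Fin 3) (ψ : Profile) :
    ∑ j, along (rot j) (along (rot j) (dipole hp i ψ)) = (-2 : ℝ) • dipole hp i ψ := by
  simp only [rot_dipole, map_sum, map_smul]
  ext x
  simp only [FunLike.coe_sum, FunLike.coe_smul, Finset.sum_apply, Pi.smul_apply, smul_eq_mul]
  fin_cases i <;> simp [rot_apply, Fin.sum_univ_three] <;> ring

theorem sum_form_dipole {p : ℝ} (hp : 0 < p) (χ : Profile) :
    ∑ i, form (dipole hp i χ) (dipole hp i χ) =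
      3 * volume.real (Metric.ball (0 : E3) 1) * (2 * p)⁻¹ * profileForm χ χ := by
  let F (r : ℝ) : ℝ := (r ^ 2)⁻¹ ^ 2 * (r ^ 2 * ((r ^ 2) ^ (-(1 / 4) : ℝ) * χ ((r ^ 2) ^ p)) ^ 2)
  have hF : ∑ i, form (dipole hp i χ) (dipole hp i χ) = ∫ x : E3, F ‖x‖ := by
    simp only [form_apply]
    rw [← integral_finsetSum _ fun i _ ↦ Test.integrable _ _]
    refine integral_congr_ae (.of_forall fun x ↦ ?_)
    simp only [F, dipole_apply, radial, weight]
    rw [← Finset.mul_sum, EuclideanSpace.real_norm_sq_eq, Finset.sum_mul]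
    congr 1
    exact Finset.sum_congr rfl fun i _ ↦ by ring
  have hq : 0 < 2 * p := by positivity
  have hr : ∫ r in Ioi (0 : ℝ), r ^ 2 * F r = (2 * p)⁻¹ * profileForm χ χ := by
    have h0 : ∫ y in Ioi (0 : ℝ), y⁻¹ * (χ y * χ y) = profileForm χ χ :=
      setIntegral_eq_integral_of_forall_compl_eq_zero fun y hy ↦ by
        rw [χ.eq_zero (not_lt.1 hy)]
        simp
    rw [← h0, ← integral_const_mul, ← integral_comp_rpow_Ioi_of_pos
      (g := fun y ↦ (2 * p)⁻¹ * (y⁻¹ * (χ y * χ y))) hq]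
    refine setIntegral_congr_fun measurableSet_Ioi fun r (hr : 0 < r) ↦ ?_
    have h1 : (r ^ 2) ^ p = r ^ (2 * p) := by
      rw [Real.rpow_mul hr.le, Real.rpow_two]
    have h2 : ((r ^ 2) ^ (-(1 / 4) : ℝ)) ^ 2 = r⁻¹ := by
      rw [← Real.rpow_two, ← Real.rpow_two, ← Real.rpow_mul hr.le, ← Real.rpow_mul hr.le,
        ← Real.rpow_neg_one]
      norm_num
    have h3 : 0 < r ^ (2 * p) := by positivity
    simp only [F, smul_eq_mul, mul_pow, h1, h2, Real.rpow_sub_one hr.ne']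
    field_simp
  rw [hF, integral_fun_norm_addHaar]
  simp only [finrank_euclideanSpace_fin, Nat.add_one_sub_one, smul_eq_mul, nsmul_eq_mul, hr]
  push_cast
  ring

/-- A smooth bump near `2` as a profile. -/
noncomputable def bump : Profile :=
  let φ : ContDiffBump (2 : ℝ) := ⟨1 / 2, 1, by norm_num, by norm_num⟩
  { toFun := φ
    contDiff' := φ.contDiff
    hasCompactSupport' := φ.hasCompactSupport
    tsupport_subset' := fun y hy ↦ by
      rw [φ.tsupport_eq, Metric.mem_closedBall, Real.dist_eq] at hy
      have h := (abs_le.1 hy).1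
      change 0 < y
      change -1 ≤ y - 2 at h
      linarith }

theorem bump_two : bump 2 = 1 :=
  ContDiffBump.one_of_mem_closedBall _ (Metric.mem_closedBall_self (by norm_num))

theorem profileForm_self_pos {χ : Profile} {y : ℝ} (hy : χ y ≠ 0) : 0 < profileForm χ χ := by
  refine (χ.integrand_continuous χ).integral_pos_of_hasCompactSupport_nonneg_nonzero
    χ.hasCompactSupport.mul_right.mul_left (x := y) (fun z ↦ ?_) ?_
  · rcases le_or_gt z 0 with hz | hz
    · simp [χ.eq_zero hz]
    · exact mul_nonneg (by positivity) (mul_self_nonneg _)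
  · have : y ≠ 0 := fun h ↦ hy (χ.eq_zero h.le)
    positivity

theorem sum_integral_gradient_sq_dipole {p : ℝ} (hp : 0 < p) (ψ : Profile) :
    ∑ i, ∫ x : E3, ‖x‖ ^ (-2 : ℝ) * ‖gradient (dipole hp i ψ) x‖ ^ 2 =
      3 * volume.real (Metric.ball (0 : E3) 1) * (2 * p)⁻¹ *
        (profileForm ((1 / 2 : ℝ) • ψ + (2 * p) • theta ψ) ((1 / 2 : ℝ) • ψ + (2 * p) • theta ψ)
          + 2 * profileForm ψ ψ) := by
  have h (i : Fin 3) : ∑ j, form (along (rot j) (dipole hp i ψ)) (along (rot j) (dipole hp i ψ))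
      = 2 * form (dipole hp i ψ) (dipole hp i ψ) := by
    simp only [form_rot]
    rw [Finset.sum_neg_distrib, ← map_sum, sum_rot_rot_dipole, map_smul, smul_eq_mul]
    ring
  simp only [integral_gradient_sq, h, euler_dipole]
  rw [Finset.sum_add_distrib, ← Finset.mul_sum, sum_form_dipole, sum_form_dipole]
  ring

theorem sum_integral_lap_sq_dipole {p : ℝ} (hp : 0 < p) (ψ : Profile) :
    ∑ i, ∫ x, lap (dipole hp i ψ) x ^ 2 =
      3 * volume.real (Metric.ball (0 : E3) 1) * (2 * p)⁻¹ *
        profileForm ((-5 / 4 : ℝ) • ψ + (4 * p) • theta ψ + (4 * p ^ 2) • theta (theta ψ))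
          ((-5 / 4 : ℝ) • ψ + (4 * p) • theta ψ + (4 * p ^ 2) • theta (theta ψ)) := by
  have h : (1 / 2 : ℝ) • ((1 / 2 : ℝ) • ψ + (2 * p) • theta ψ)
      + (2 * p) • theta ((1 / 2 : ℝ) • ψ + (2 * p) • theta ψ)
      + ((1 / 2 : ℝ) • ψ + (2 * p) • theta ψ) + (-2 : ℝ) • ψ
      = (-5 / 4 : ℝ) • ψ + (4 * p) • theta ψ + (4 * p ^ 2) • theta (theta ψ) := by
    rw [map_add, map_smul, map_smul]
    module
  rw [← sum_form_dipole hp, ← h]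
  refine Finset.sum_congr rfl fun i _ ↦ ?_
  rw [integral_lap_sq, euler_dipole, euler_dipole, sum_rot_rot_dipole, ← dipole_smul,
    ← dipole_add, ← dipole_add]

/-- No constant larger than `25 / 36` is admissible. -/
theorem le_of_forall_le {m : ℝ} (hm : ∀ f : Test,
    m * ∫ x : E3, ‖x‖ ^ (-2 : ℝ) * ‖gradient f x‖ ^ 2 ≤ ∫ x, lap f x ^ 2) : m ≤ 25 / 36 := by
  have hV : 0 < 3 * volume.real (Metric.ball (0 : E3) 1) :=
    mul_pos (by norm_num) (ENNReal.toReal_pos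
      (Metric.measure_ball_pos _ _ one_pos).ne' measure_ball_lt_top.ne)
  let G (p : ℝ) : ℝ := m * (profileForm ((1 / 2 : ℝ) • bump + (2 * p) • theta bump)
    ((1 / 2 : ℝ) • bump + (2 * p) • theta bump) + 2 * profileForm bump bump)
  let H (p : ℝ) : ℝ :=
    profileForm ((-5 / 4 : ℝ) • bump + (4 * p) • theta bump + (4 * p ^ 2) • theta (theta bump))
      ((-5 / 4 : ℝ) • bump + (4 * p) • theta bump + (4 * p ^ 2) • theta (theta bump))
  have hGH : ∀ p ∈ Ioi (0 : ℝ), G p ≤ H p := fun p (hp : 0 < p) ↦ by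
    have h := Finset.sum_le_sum fun i (_ : i ∈ Finset.univ) ↦ hm (dipole hp i bump)
    rw [← Finset.mul_sum, sum_integral_gradient_sq_dipole, sum_integral_lap_sq_dipole,
      mul_left_comm] at h
    exact le_of_mul_le_mul_left h (mul_pos hV (inv_pos.2 (mul_pos two_pos hp)))
  have hG : Continuous G := by
    simp only [G, map_add, map_smul, LinearMap.add_apply, LinearMap.smul_apply, smul_eq_mul]
    fun_prop
  have hH : Continuous H := by
    simp only [H, map_add, map_smul, LinearMap.add_apply, LinearMap.smul_apply, smul_eq_mul]
    fun_prop
  have h0 : G 0 ≤ H 0 := le_of_tendsto_of_tendsto (hG.tendsto 0 |>.mono_left nhdsWithin_le_nhds)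
    (hH.tendsto 0 |>.mono_left nhdsWithin_le_nhds) (eventually_mem_nhdsWithin.mono hGH)
  have hpos : 0 < profileForm bump bump := profileForm_self_pos (y := 2) (by simp [bump_two])
  simp only [G, H, mul_zero, zero_smul, add_zero, ne_eq, OfNat.ofNat_ne_zero, not_false_eq_true,
    zero_pow, map_smul, LinearMap.smul_apply, smul_eq_mul] at h0
  refine le_of_mul_le_mul_right ?_ hpos
  linarith

theorem exists_integral_gradient_sq_ne_zero :
    ∃ f : Test, (∫ x : E3, ‖x‖ ^ (-2 : ℝ) * ‖gradient f x‖ ^ 2) ≠ 0 := by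
  by_contra! h
  have := le_of_forall_le (m := 1) fun f ↦ by
    rw [h f, mul_zero]
    exact integral_nonneg fun x ↦ sq_nonneg _
  norm_num at this

end HardyRellich

theorem statement6 :
    sInf {r : ℝ | ∃ u : EuclideanSpace ℝ (Fin 3) → ℝ,
        ContDiff ℝ 2 u ∧ HasCompactSupport u ∧
        (0 : EuclideanSpace ℝ (Fin 3)) ∉ tsupport u ∧
        (∫ x : EuclideanSpace ℝ (Fin 3), ‖x‖ ^ (-2 : ℝ) * ‖gradient u x‖ ^ 2) ≠ 0 ∧
        r = (∫ x : EuclideanSpace ℝ (Fin 3), (lap u x) ^ 2) /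
            (∫ x : EuclideanSpace ℝ (Fin 3), ‖x‖ ^ (-2 : ℝ) * ‖gradient u x‖ ^ 2)} =
      25 / 36 := by
  have hden (u : EuclideanSpace ℝ (Fin 3) → ℝ) :
      0 ≤ ∫ x : EuclideanSpace ℝ (Fin 3), ‖x‖ ^ (-2 : ℝ) * ‖gradient u x‖ ^ 2 :=
    integral_nonneg fun x ↦ by positivity
  have hlower : ∀ r ∈ {r : ℝ | ∃ u : EuclideanSpace ℝ (Fin 3) → ℝ,
        ContDiff ℝ 2 u ∧ HasCompactSupport u ∧
        (0 : EuclideanSpace ℝ (Fin 3)) ∉ tsupport u ∧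
        (∫ x : EuclideanSpace ℝ (Fin 3), ‖x‖ ^ (-2 : ℝ) * ‖gradient u x‖ ^ 2) ≠ 0 ∧
        r = (∫ x : EuclideanSpace ℝ (Fin 3), (lap u x) ^ 2) /
            (∫ x : EuclideanSpace ℝ (Fin 3), ‖x‖ ^ (-2 : ℝ) * ‖gradient u x‖ ^ 2)},
      25 / 36 ≤ r := by
    rintro r ⟨u, hu, hc, h0, hne, rfl⟩
    rw [le_div_iff₀ ((hden u).lt_of_ne' hne)]
    exact HardyRellich.rellich_ineq hu hc h0
  apply le_antisymm
  · refine HardyRellich.le_of_forall_le fun f ↦ ?_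
    by_cases hne : (∫ x : EuclideanSpace ℝ (Fin 3), ‖x‖ ^ (-2 : ℝ) * ‖gradient f x‖ ^ 2) = 0
    · rw [hne, mul_zero]
      exact integral_nonneg fun x ↦ sq_nonneg _
    · rw [← le_div_iff₀ ((hden f).lt_of_ne' hne)]
      exact csInf_le ⟨25 / 36, hlower⟩
        ⟨f, f.contDiff_two, f.hasCompactSupport, f.zero_notMem, hne, rfl⟩
  · obtain ⟨f, hf⟩ := HardyRellich.exists_integral_gradient_sq_ne_zero
    exact le_csInf ⟨_, f, f.contDiff_two, f.hasCompactSupport, f.zero_notMem, hf, rfl⟩ hlower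
end

section
/- The infimum, over all functions u : ℝ⁴ → ℝ of class C² with compact support contained in ℝ⁴ \ {0} and with ∫_{ℝ⁴} |x|^{-2} |∇u(x)|² dx ≠ 0, of the quotient (∫_{ℝ⁴} |Δu(x)|² dx) / (∫_{ℝ⁴} |x|^{-2} |∇u(x)|² dx) equals 3. In particular ∫_{ℝ⁴} |Δu|² dx ≥ 3 ∫_{ℝ⁴} |x|^{-2} |∇u|² dx for all such u, and 3 is the best constant. -/
open MeasureTheory

open Metric Set Filter Topology
open scoped ContDiff

/-- Euclidean four-space. -/
abbrev FourSpace := EuclideanSpace ℝ (Fin 4)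

/-- A compactly supported `C¹` function is approximated by smooth functions whose derivatives
converge uniformly. -/
lemma exists_contDiff_fderiv_close {f : FourSpace → ℝ} (hf : ContDiff ℝ 1 f)
    (hc : HasCompactSupport f) {ε : ℝ} (hε : 0 < ε) :
    ∃ g : FourSpace → ℝ, ContDiff ℝ 2 g ∧ ∀ x, ‖fderiv ℝ g x - fderiv ℝ f x‖ ≤ ε := by
  have hdc : Continuous (fderiv ℝ f) := hf.continuous_fderiv one_ne_zero
  obtain ⟨δ, hδ, hu⟩ := Metric.uniformContinuous_iff.1
    ((hc.fderiv ℝ).uniformContinuous_of_continuous hdc) ε hε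
  let φ : ContDiffBump (0 : FourSpace) := ⟨δ / 2, δ, by positivity, by linarith⟩
  refine ⟨convolution (φ.normed volume) f (ContinuousLinearMap.lsmul ℝ ℝ) volume, ?_, fun x => ?_⟩
  · exact φ.hasCompactSupport_normed.contDiff_convolution_left _ φ.contDiff_normed
      hf.continuous.locallyIntegrable
  · have h := (hc.hasFDerivAt_convolution_right (ContinuousLinearMap.lsmul ℝ ℝ)
      (μ := volume) (f := φ.normed volume) φ.continuous_normed.locallyIntegrable hf x).fderiv
    rw [h, ← dist_eq_norm]
    exact φ.dist_normed_convolution_le hdc.aestronglyMeasurable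
      (fun y hy => (hu (mem_ball.1 hy)).le)

/-- `C^k` functions with compact support away from the origin. -/
structure PuncturedSupport (k : ℕ∞ω) (h : FourSpace → ℝ) : Prop where
  contDiff : ContDiff ℝ k h
  compact : HasCompactSupport h
  zero_notMem : (0 : FourSpace) ∉ tsupport h

namespace PuncturedSupport

variable {k : ℕ∞ω} {f h : FourSpace → ℝ}

lemma of_le {l : ℕ∞ω} (hh : PuncturedSupport k h) (hl : l ≤ k) : PuncturedSupport l h :=
  ⟨hh.contDiff.of_le hl, hh.compact, hh.zero_notMem⟩

lemma mul (hf : ContDiff ℝ k f) (hh : PuncturedSupport k h) :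
    PuncturedSupport k (fun x => f x * h x) :=
  ⟨hf.mul hh.contDiff, hh.compact.mul_left, fun h0 => hh.zero_notMem (tsupport_mul_subset_right h0)⟩

lemma eventually_zero (hh : PuncturedSupport k h) : ∀ᶠ x in 𝓝 (0 : FourSpace), h x = 0 :=
  notMem_tsupport_iff_eventuallyEq.1 hh.zero_notMem

lemma mul_off_zero (hf : ∀ x ≠ 0, ContDiffAt ℝ k f x) (hh : PuncturedSupport k h) :
    PuncturedSupport k (fun x => f x * h x) := by
  refine ⟨contDiff_iff_contDiffAt.2 fun x => ?_, hh.compact.mul_left,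
    fun h0 => hh.zero_notMem (tsupport_mul_subset_right h0)⟩
  by_cases hx : x = 0
  · subst hx
    refine (contDiffAt_const (c := (0 : ℝ))).congr_of_eventuallyEq ?_
    filter_upwards [hh.eventually_zero] with y hy
    simp [hy]
  · exact (hf x hx).mul hh.contDiff.contDiffAt

lemma integrable (hh : PuncturedSupport k h) : Integrable h :=
  hh.contDiff.continuous.integrable_of_hasCompactSupport hh.compact

lemma add (hf : PuncturedSupport k f) (hh : PuncturedSupport k h) :
    PuncturedSupport k (fun x => f x + h x) := by
  refine ⟨hf.contDiff.add hh.contDiff, hf.compact.add hh.compact, ?_⟩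
  rw [notMem_tsupport_iff_eventuallyEq]
  filter_upwards [hf.eventually_zero, hh.eventually_zero] with x h1 h2
  simp [h1, h2]

end PuncturedSupport

/-- The derivative of `f` along the linear vector field `x ↦ A x`. -/
noncomputable def linDeriv (A : FourSpace →L[ℝ] FourSpace) (f : FourSpace → ℝ)
    (x : FourSpace) : ℝ :=
  fderiv ℝ f x (A x)

lemma PuncturedSupport.linDeriv {k l : ℕ∞ω} {h : FourSpace → ℝ} (hh : PuncturedSupport k h)
    (hl : l + 1 ≤ k) (A : FourSpace →L[ℝ] FourSpace) : PuncturedSupport l (linDeriv A h) := by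
  refine ⟨(hh.contDiff.fderiv_right hl).clm_apply A.contDiff, ?_, ?_⟩
  · refine (hh.compact.fderiv ℝ).mono fun x hx => ?_
    simp only [Function.mem_support, _root_.linDeriv] at hx ⊢
    intro h0
    simp [h0] at hx
  · rw [notMem_tsupport_iff_eventuallyEq]
    filter_upwards [(notMem_tsupport_iff_eventuallyEq.1 hh.zero_notMem).fderiv (𝕜 := ℝ)] with x hx
    simp [_root_.linDeriv, hx]

lemma linDeriv_mul {A : FourSpace →L[ℝ] FourSpace} {f g : FourSpace → ℝ} {x : FourSpace}
    (hf : DifferentiableAt ℝ f x) (hg : DifferentiableAt ℝ g x) :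
    linDeriv A (fun y => f y * g y) x = linDeriv A f x * g x + f x * linDeriv A g x := by
  simp only [linDeriv]
  rw [fderiv_fun_mul hf hg]
  simp
  ring

lemma linDeriv_linDeriv {A B : FourSpace →L[ℝ] FourSpace} {f : FourSpace → ℝ}
    (hf : ContDiff ℝ 2 f) (x : FourSpace) :
    linDeriv A (linDeriv B f) x = fderiv ℝ (fderiv ℝ f) x (A x) (B x) + fderiv ℝ f x (B (A x)) := by
  have h1 : DifferentiableAt ℝ (fderiv ℝ f) x :=
    ((hf.fderiv_right (m := 1) (by norm_num)).differentiable one_ne_zero) x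
  have h2 : HasFDerivAt (linDeriv B f) _ x := h1.hasFDerivAt.clm_apply B.hasFDerivAt
  rw [linDeriv, h2.fderiv]
  simp [add_comm]

lemma linDeriv_comm {A B : FourSpace →L[ℝ] FourSpace} {f : FourSpace → ℝ}
    (hf : ContDiff ℝ 2 f) (x : FourSpace) :
    linDeriv A (linDeriv B f) x - linDeriv B (linDeriv A f) x
      = fderiv ℝ f x (B (A x) - A (B x)) := by
  have hs : IsSymmSndFDerivAt ℝ f x := hf.contDiffAt.isSymmSndFDerivAt (by simp)
  rw [linDeriv_linDeriv hf, linDeriv_linDeriv hf, hs.eq, map_sub]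
  ring

/-- The divergence theorem for a linear vector field. -/
lemma integral_linDeriv (A : FourSpace →L[ℝ] FourSpace) {h : FourSpace → ℝ}
    (hh : ContDiff ℝ 1 h) (hc : HasCompactSupport h) :
    ∫ x, linDeriv A h x = -((∑ i, A (EuclideanSpace.single i 1) i) * ∫ x, h x) := by
  have hdc : Continuous (fderiv ℝ h) := hh.continuous_fderiv one_ne_zero
  have key : ∀ i : Fin 4,
      Integrable (fun x => A x i * fderiv ℝ h x (EuclideanSpace.single i 1)) ∧
      ∫ x, A x i * fderiv ℝ h x (EuclideanSpace.single i 1)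
        = -(A (EuclideanSpace.single i 1) i * ∫ x, h x) := by
    intro i
    let L : FourSpace →L[ℝ] ℝ := (EuclideanSpace.proj i : FourSpace →L[ℝ] ℝ).comp A
    have hL : ∀ x, fderiv ℝ (fun x => L x) x = L := fun x => L.fderiv
    have hi : Integrable (fun x => L x * fderiv ℝ h x (EuclideanSpace.single i 1)) :=
      (L.continuous.mul (hdc.clm_apply continuous_const)).integrable_of_hasCompactSupport
        (hc.fderiv_apply ℝ _).mul_left
    have hInt : Integrable h := hh.continuous.integrable_of_hasCompactSupport hc
    have := integral_mul_fderiv_eq_neg_fderiv_mul_of_integrable (μ := volume) (f := fun x => L x)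
      (g := h) (v := EuclideanSpace.single i (1 : ℝ)) (by simpa only [hL] using hInt.const_mul _) hi
      ((L.continuous.mul hh.continuous).integrable_of_hasCompactSupport hc.mul_left)
      (fun x _ => L.differentiableAt) (fun x _ => (hh.differentiable one_ne_zero) x)
    refine ⟨hi, ?_⟩
    simp only [hL] at this
    rw [integral_const_mul] at this
    exact this
  have hsum : ∀ x, linDeriv A h x
      = ∑ i, A x i * fderiv ℝ h x (EuclideanSpace.single i 1) := by
    intro x
    conv_lhs => rw [linDeriv, ← (EuclideanSpace.basisFun (Fin 4) ℝ).sum_repr (A x)]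
    simp
  simp_rw [hsum]
  rw [integral_finsetSum _ fun i _ => (key i).1, Finset.sum_mul, ← Finset.sum_neg_distrib]
  exact Finset.sum_congr rfl fun i _ => (key i).2

/-- The density of the dilation-invariant measure `|x|⁻⁴ dx` on the punctured four-space. -/
noncomputable def dilationWeight (x : FourSpace) : ℝ := (‖x‖ ^ 4)⁻¹

lemma hasFDerivAt_norm_sq (x : FourSpace) :
    HasFDerivAt (fun y : FourSpace => ‖y‖ ^ 2) ((2 : ℝ) • innerSL ℝ x) x := by
  have := (hasStrictFDerivAt_norm_sq x).hasFDerivAt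
  rwa [two_nsmul, ← two_smul ℝ] at this

lemma hasFDerivAt_dilationWeight {x : FourSpace} (hx : x ≠ 0) :
    HasFDerivAt dilationWeight ((-4 * (‖x‖ ^ 6)⁻¹) • innerSL ℝ x) x := by
  have hn : ‖x‖ ≠ 0 := norm_ne_zero_iff.2 hx
  have h1 := hasFDerivAt_norm_sq x
  have h2 := (hasDerivAt_zpow (-2) (‖x‖ ^ 2) (Or.inl (by positivity))).comp_hasFDerivAt x h1
  have e : dilationWeight = (fun t : ℝ => t ^ (-2 : ℤ)) ∘ fun y : FourSpace => ‖y‖ ^ 2 := by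
    ext y
    simp only [dilationWeight, Function.comp]
    rw [zpow_neg]
    norm_cast
    rw [← pow_mul]
  rw [e]
  refine h2.congr_fderiv ?_
  rw [smul_smul]
  congr 1
  rw [show (-2 : ℤ) - 1 = -3 by norm_num, zpow_neg]
  norm_cast
  rw [← pow_mul]
  push_cast
  ring

lemma contDiffAt_dilationWeight {k : ℕ∞ω} {x : FourSpace} (hx : x ≠ 0) :
    ContDiffAt ℝ k dilationWeight x :=
  ((contDiffAt_norm ℝ hx).pow 4).inv (pow_ne_zero 4 (norm_ne_zero_iff.2 hx))

lemma dilationWeight_nonneg (x : FourSpace) : 0 ≤ dilationWeight x := by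
  unfold dilationWeight; positivity

lemma PuncturedSupport.weighted {k : ℕ∞ω} {h : FourSpace → ℝ} (hh : PuncturedSupport k h) :
    PuncturedSupport k (fun x => dilationWeight x * h x) :=
  hh.mul_off_zero fun _ => contDiffAt_dilationWeight

/-- Functions that are integrable with vanishing integral for `|x|⁻⁴ dx`. -/
def WeightedNull (h : FourSpace → ℝ) : Prop :=
  Integrable (fun x => dilationWeight x * h x) ∧ ∫ x, dilationWeight x * h x = 0

namespace WeightedNull

variable {f g : FourSpace → ℝ}

lemma add (hf : WeightedNull f) (hg : WeightedNull g) : WeightedNull (fun x => f x + g x) := by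
  have e : (fun x => dilationWeight x * (f x + g x))
      = fun x => dilationWeight x * f x + dilationWeight x * g x := by ext; ring
  refine ⟨by rw [e]; exact hf.1.add hg.1, ?_⟩
  rw [e, integral_add hf.1 hg.1, hf.2, hg.2, add_zero]

lemma const_mul (hf : WeightedNull f) (c : ℝ) : WeightedNull (fun x => c * f x) := by
  have e : (fun x => dilationWeight x * (c * f x))
      = fun x => c * (dilationWeight x * f x) := by ext; ring
  refine ⟨by rw [e]; exact hf.1.const_mul c, ?_⟩
  rw [e, integral_const_mul, hf.2, mul_zero]

lemma sub (hf : WeightedNull f) (hg : WeightedNull g) : WeightedNull (fun x => f x - g x) := by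
  simpa [sub_eq_add_neg] using hf.add (hg.const_mul (-1))

lemma integral_nonneg_of_le (hf : WeightedNull f)
    (hg : Integrable (fun x => dilationWeight x * g x)) (hfg : ∀ x, f x ≤ g x) :
    0 ≤ ∫ x, dilationWeight x * g x := by
  rw [← hf.2]
  exact integral_mono hf.1 hg fun x => mul_le_mul_of_nonneg_left (hfg x) (dilationWeight_nonneg x)

end WeightedNull

/-- A linear vector field preserving the measure `|x|⁻⁴ dx`. -/
def IsConformalField (A : FourSpace →L[ℝ] FourSpace) : Prop :=
  ∀ h, PuncturedSupport 1 h → WeightedNull (linDeriv A h)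

lemma isConformalField_of_inner {A : FourSpace →L[ℝ] FourSpace} {c : ℝ}
    (hA : ∀ x, inner ℝ x (A x) = c * ‖x‖ ^ 2)
    (htr : ∑ i, A (EuclideanSpace.single i 1) i = 4 * c) : IsConformalField A := by
  intro h hh
  have hi := (hh.linDeriv (l := 0) (by norm_num) A).weighted.integrable
  refine ⟨hi, ?_⟩
  have hH := hh.weighted
  have key : ∀ x, linDeriv A (fun y => dilationWeight y * h y) x
      = -4 * c * (dilationWeight x * h x) + dilationWeight x * linDeriv A h x := by
    intro x
    by_cases hx : x = 0
    · subst hx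
      have h0 : h 0 = 0 := hh.eventually_zero.self_of_nhds
      simp [linDeriv, h0]
    · have hw := hasFDerivAt_dilationWeight hx
      rw [linDeriv_mul hw.differentiableAt ((hh.contDiff.differentiable one_ne_zero) x), linDeriv,
        hw.fderiv]
      have hn : ‖x‖ ≠ 0 := norm_ne_zero_iff.2 hx
      simp only [smul_apply, innerSL_apply_apply, hA, smul_eq_mul,
        dilationWeight]
      field_simp
  have h1 := integral_linDeriv A hH.contDiff hH.compact
  simp_rw [key] at h1
  rw [integral_add (hH.integrable.const_mul _) hi, integral_const_mul, htr] at h1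
  linarith

lemma IsConformalField.sub_comm_of_contDiff {A B : FourSpace →L[ℝ] FourSpace}
    (hA : IsConformalField A) (hB : IsConformalField B) {f g : FourSpace → ℝ}
    (hf : ContDiff ℝ 2 f) (hg : PuncturedSupport 1 g) :
    WeightedNull (fun x => linDeriv A f x * linDeriv B g x - linDeriv B f x * linDeriv A g x
      - g x * fderiv ℝ f x (B (A x) - A (B x))) := by
  have hd : ∀ C : FourSpace →L[ℝ] FourSpace, ContDiff ℝ 1 (linDeriv C f) := fun C =>
    (hf.fderiv_right (m := 1) (by norm_num)).clm_apply C.contDiff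
  have hgd := hg.contDiff.differentiable one_ne_zero
  convert (hB _ (hg.mul (hd A))).sub (hA _ (hg.mul (hd B))) using 2 with x
  rw [linDeriv_mul ((hd A).differentiable one_ne_zero x) (hgd x),
    linDeriv_mul ((hd B).differentiable one_ne_zero x) (hgd x), ← linDeriv_comm hf x]
  ring

/-- Two integrations by parts, moving each of two derivatives to the other factor. -/
lemma IsConformalField.sub_comm {A B : FourSpace →L[ℝ] FourSpace}
    (hA : IsConformalField A) (hB : IsConformalField B) {f g : FourSpace → ℝ}
    (hf : ContDiff ℝ 1 f) (hc : HasCompactSupport f) (hg : PuncturedSupport 1 g) :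
    WeightedNull (fun x => linDeriv A f x * linDeriv B g x - linDeriv B f x * linDeriv A g x
      - g x * fderiv ℝ f x (B (A x) - A (B x))) := by
  have hgd : ∀ C : FourSpace →L[ℝ] FourSpace, PuncturedSupport 0 (linDeriv C g) := fun C =>
    hg.linDeriv (by norm_num) C
  have hg0 : PuncturedSupport 0 g := hg.of_le (by norm_num)
  let C : FourSpace →L[ℝ] FourSpace := B.comp A - A.comp B
  have hC : ∀ x, B (A x) - A (B x) = C x := fun x => rfl
  simp only [hC]
  have hfd : ∀ D : FourSpace →L[ℝ] FourSpace, ContDiff ℝ 0 (linDeriv D f) := fun D =>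
    (hf.fderiv_right (m := 0) (by norm_num)).clm_apply D.contDiff
  have hInt : Integrable (fun x => dilationWeight x * (linDeriv A f x * linDeriv B g x
      - linDeriv B f x * linDeriv A g x - g x * fderiv ℝ f x (C x))) := by
    refine ((((hgd B).mul (hfd A)).weighted.integrable.sub
      ((hgd A).mul (hfd B)).weighted.integrable).sub
      (hg0.mul (hfd C)).weighted.integrable).congr (Eventually.of_forall fun x => ?_)
    simp only [Pi.sub_apply, linDeriv]
    ring
  refine ⟨hInt, ?_⟩
  have hn : ∀ D : FourSpace →L[ℝ] FourSpace, ContDiff ℝ 0 (fun x => ‖D x‖) := fun D =>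
    contDiff_zero.2 D.continuous.norm
  have hk1 := ((hgd B).mul (hn A)).weighted.integrable.norm
  have hk2 := ((hgd A).mul (hn B)).weighted.integrable.norm
  have hk3 := (hg0.mul (hn C)).weighted.integrable.norm
  have hk := (hk1.add hk2).add hk3
  set k : FourSpace → ℝ := _ with hkdef
  change Integrable k at hk
  have bound : ∀ ε > 0, |∫ x, dilationWeight x * (linDeriv A f x * linDeriv B g x
      - linDeriv B f x * linDeriv A g x - g x * fderiv ℝ f x (C x))| ≤ ε * ∫ x, k x := by
    intro ε hε
    obtain ⟨F, hF, hcl⟩ := exists_contDiff_fderiv_close hf hc hε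
    obtain ⟨hFi, hF0⟩ := hA.sub_comm_of_contDiff hB hF hg
    simp only [hC] at hFi hF0
    rw [← integral_const_mul, ← sub_zero (∫ x, _), ← hF0, ← integral_sub hInt hFi,
      ← Real.norm_eq_abs]
    refine norm_integral_le_of_norm_le (hk.const_mul ε) (Eventually.of_forall fun x => ?_)
    have hv : ∀ v : FourSpace, |fderiv ℝ f x v - fderiv ℝ F x v| ≤ ε * ‖v‖ := fun v => by
      rw [abs_sub_comm, ← Real.norm_eq_abs]
      exact ContinuousLinearMap.le_of_opNorm_le (fderiv ℝ F x - fderiv ℝ f x) (hcl x) v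
    have e : dilationWeight x * (linDeriv A f x * linDeriv B g x
        - linDeriv B f x * linDeriv A g x - g x * fderiv ℝ f x (C x))
        - dilationWeight x * (linDeriv A F x * linDeriv B g x
        - linDeriv B F x * linDeriv A g x - g x * fderiv ℝ F x (C x))
        = dilationWeight x * ((fderiv ℝ f x (A x) - fderiv ℝ F x (A x)) * linDeriv B g x
          - (fderiv ℝ f x (B x) - fderiv ℝ F x (B x)) * linDeriv A g x
          - (fderiv ℝ f x (C x) - fderiv ℝ F x (C x)) * g x) := by
      simp only [linDeriv]
      ring
    rw [e, hkdef]
    simp only [Pi.add_apply, norm_mul, Real.norm_eq_abs, abs_norm,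
      abs_of_nonneg (dilationWeight_nonneg x)]
    rw [← mul_add, ← mul_add, mul_left_comm]
    refine mul_le_mul_of_nonneg_left ?_ (dilationWeight_nonneg x)
    refine (abs_sub _ _).trans ?_
    refine (add_le_add_left (abs_sub _ _) _).trans ?_
    simp only [abs_mul]
    rw [mul_add, mul_add, ← mul_assoc, ← mul_assoc, ← mul_assoc]
    gcongr <;> exact hv _
  by_contra hne
  have hpos := abs_pos.2 hne
  have hK : 0 ≤ ∫ x, k x := integral_nonneg fun x => by
    simp only [hkdef, Pi.add_apply, Pi.zero_apply]; positivity
  have := bound (|∫ x, dilationWeight x * (linDeriv A f x * linDeriv B g x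
      - linDeriv B f x * linDeriv A g x - g x * fderiv ℝ f x (C x))| / (2 * ((∫ x, k x) + 1)))
    (by positivity)
  rw [div_mul_eq_mul_div, le_div_iff₀ (by positivity)] at this
  nlinarith

/-- Left multiplication by the quaternion `i`. -/
noncomputable def leftI : FourSpace →L[ℝ] FourSpace := LinearMap.toContinuousLinearMap
  { toFun := fun x => !₂[-x 1, x 0, -x 3, x 2]
    map_add' := fun x y => by ext i; fin_cases i <;> simp <;> ring
    map_smul' := fun c x => by ext i; fin_cases i <;> simp }

/-- Left multiplication by the quaternion `j`. -/
noncomputable def leftJ : FourSpace →L[ℝ] FourSpace := LinearMap.toContinuousLinearMap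
  { toFun := fun x => !₂[-x 2, x 3, x 0, -x 1]
    map_add' := fun x y => by ext i; fin_cases i <;> simp <;> ring
    map_smul' := fun c x => by ext i; fin_cases i <;> simp }

/-- Left multiplication by the quaternion `k`. -/
noncomputable def leftK : FourSpace →L[ℝ] FourSpace := LinearMap.toContinuousLinearMap
  { toFun := fun x => !₂[-x 3, -x 2, x 1, x 0]
    map_add' := fun x y => by ext i; fin_cases i <;> simp <;> ring
    map_smul' := fun c x => by ext i; fin_cases i <;> simp }

lemma leftI_apply (x : FourSpace) : leftI x = !₂[-x 1, x 0, -x 3, x 2] := rfl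

lemma leftJ_apply (x : FourSpace) : leftJ x = !₂[-x 2, x 3, x 0, -x 1] := rfl

lemma leftK_apply (x : FourSpace) : leftK x = !₂[-x 3, -x 2, x 1, x 0] := rfl

/-- The generator of dilations. -/
noncomputable abbrev eulerField : FourSpace →L[ℝ] FourSpace := ContinuousLinearMap.id ℝ FourSpace

lemma leftI_leftI (x : FourSpace) : leftI (leftI x) = -x := by
  ext i; fin_cases i <;> simp [leftI_apply]

lemma leftJ_leftJ (x : FourSpace) : leftJ (leftJ x) = -x := by
  ext i; fin_cases i <;> simp [leftJ_apply]

lemma leftK_leftK (x : FourSpace) : leftK (leftK x) = -x := by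
  ext i; fin_cases i <;> simp [leftK_apply]

lemma leftJ_leftI_sub (x : FourSpace) :
    leftJ (leftI x) - leftI (leftJ x) = (-2 : ℝ) • leftK x := by
  ext i; fin_cases i <;> simp [leftI_apply, leftJ_apply, leftK_apply] <;> ring

lemma leftK_leftJ_sub (x : FourSpace) :
    leftK (leftJ x) - leftJ (leftK x) = (-2 : ℝ) • leftI x := by
  ext i; fin_cases i <;> simp [leftI_apply, leftJ_apply, leftK_apply] <;> ring

lemma leftI_leftK_sub (x : FourSpace) :
    leftI (leftK x) - leftK (leftI x) = (-2 : ℝ) • leftJ x := by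
  ext i; fin_cases i <;> simp [leftI_apply, leftJ_apply, leftK_apply] <;> ring

lemma inner_leftI (x : FourSpace) : inner ℝ x (leftI x) = 0 := by
  simp [PiLp.inner_apply, Fin.sum_univ_four, leftI_apply]; ring

lemma inner_leftJ (x : FourSpace) : inner ℝ x (leftJ x) = 0 := by
  simp [PiLp.inner_apply, Fin.sum_univ_four, leftJ_apply]; ring

lemma inner_leftK (x : FourSpace) : inner ℝ x (leftK x) = 0 := by
  simp [PiLp.inner_apply, Fin.sum_univ_four, leftK_apply]; ring

lemma isConformalField_euler : IsConformalField eulerField :=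
  isConformalField_of_inner (c := 1) (fun x => by simp) (by simp)

lemma isConformalField_leftI : IsConformalField leftI :=
  isConformalField_of_inner (c := 0) (fun x => by simp [inner_leftI])
    (by simp [Fin.sum_univ_four, leftI_apply])

lemma isConformalField_leftJ : IsConformalField leftJ :=
  isConformalField_of_inner (c := 0) (fun x => by simp [inner_leftJ])
    (by simp [Fin.sum_univ_four, leftJ_apply])

lemma isConformalField_leftK : IsConformalField leftK :=
  isConformalField_of_inner (c := 0) (fun x => by simp [inner_leftK])
    (by simp [Fin.sum_univ_four, leftK_apply])

/-- The Laplacian multiplied by `|x|²`, written in the frame of conformal fields. -/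
noncomputable def frameLaplacian (u : FourSpace → ℝ) (x : FourSpace) : ℝ :=
  linDeriv eulerField (linDeriv eulerField u) x + 2 * linDeriv eulerField u x
    + linDeriv leftI (linDeriv leftI u) x + linDeriv leftJ (linDeriv leftJ u) x
    + linDeriv leftK (linDeriv leftK u) x

/-- The squared gradient multiplied by `|x|²`, written in the frame of conformal fields. -/
noncomputable def frameEnergy (u : FourSpace → ℝ) (x : FourSpace) : ℝ :=
  linDeriv eulerField u x ^ 2 + linDeriv leftI u x ^ 2 + linDeriv leftJ u x ^ 2
    + linDeriv leftK u x ^ 2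

lemma frameLaplacian_eq {u : FourSpace → ℝ} (hu : ContDiff ℝ 2 u) (x : FourSpace) :
    frameLaplacian u x = ‖x‖ ^ 2 * lap u x := by
  simp only [frameLaplacian, lap, linDeriv_linDeriv hu, leftI_leftI, leftJ_leftJ, leftK_leftK,
    iteratedFDeriv_two_apply, ContinuousLinearMap.id_apply, map_neg,
    Matrix.cons_val_zero, Matrix.cons_val_one]
  simp only [linDeriv, ContinuousLinearMap.id_apply]
  set T := fderiv ℝ (fderiv ℝ u) x
  have hT : ∀ v w : FourSpace, T v w = ∑ i, ∑ j, v i * w j *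
      T (EuclideanSpace.single i 1) (EuclideanSpace.single j 1) := by
    intro v w
    conv_lhs => rw [← (EuclideanSpace.basisFun (Fin 4) ℝ).sum_repr v,
      ← (EuclideanSpace.basisFun (Fin 4) ℝ).sum_repr w]
    simp only [map_sum, map_smul, sum_apply, smul_apply, smul_eq_mul,
      EuclideanSpace.basisFun_apply, EuclideanSpace.basisFun_repr, Finset.mul_sum]
    rw [Finset.sum_comm]
    refine Finset.sum_congr rfl fun i _ => Finset.sum_congr rfl fun j _ => by ring
  rw [hT x x, hT (leftI x), hT (leftJ x), hT (leftK x)]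
  simp only [EuclideanSpace.norm_sq_eq, Fin.sum_univ_four, leftI_apply, leftJ_apply, leftK_apply,
    Matrix.cons_val, Real.norm_eq_abs, sq_abs]
  ring

lemma frameEnergy_eq (u : FourSpace → ℝ) (x : FourSpace) :
    frameEnergy u x = ‖x‖ ^ 2 * ‖gradient u x‖ ^ 2 := by
  have h : ∀ v, fderiv ℝ u x v = inner ℝ (gradient u x) v := fun v => by
    simp [gradient]
  simp only [frameEnergy, linDeriv, h, ContinuousLinearMap.id_apply]
  simp only [EuclideanSpace.norm_sq_eq, Fin.sum_univ_four, leftI_apply, leftJ_apply, leftK_apply,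
    Matrix.cons_val, Real.norm_eq_abs, sq_abs, PiLp.inner_apply]
  simp
  ring

lemma integrand_lap_eq {u : FourSpace → ℝ} (hu : PuncturedSupport 2 u) (x : FourSpace) :
    lap u x ^ 2 = dilationWeight x * frameLaplacian u x ^ 2 := by
  rw [frameLaplacian_eq hu.contDiff]
  by_cases hx : x = 0
  · subst hx
    have h : u =ᶠ[𝓝 0] fun _ => 0 := hu.eventually_zero
    have := (h.fderiv (𝕜 := ℝ)).fderiv_eq (𝕜 := ℝ)
    simp [lap, iteratedFDeriv_two_apply, this]
  · have hn : ‖x‖ ≠ 0 := norm_ne_zero_iff.2 hx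
    simp only [dilationWeight]
    field_simp

lemma integrand_gradient_eq {u : FourSpace → ℝ} (x : FourSpace) :
    ‖x‖ ^ (-2 : ℝ) * ‖gradient u x‖ ^ 2 = dilationWeight x * frameEnergy u x := by
  rw [frameEnergy_eq, show (-2 : ℝ) = ((-2 : ℤ) : ℝ) by norm_num, Real.rpow_intCast]
  by_cases hx : x = 0
  · subst hx
    simp [dilationWeight]
  · have hn : ‖x‖ ≠ 0 := norm_ne_zero_iff.2 hx
    simp only [dilationWeight]
    rw [zpow_neg]
    norm_cast
    field_simp

lemma IsConformalField.leibniz {A : FourSpace →L[ℝ] FourSpace} (hA : IsConformalField A)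
    {f g : FourSpace → ℝ} (hf : PuncturedSupport 1 f) (hg : PuncturedSupport 1 g) :
    WeightedNull (fun x => linDeriv A f x * g x + f x * linDeriv A g x) := by
  convert hA _ (hg.mul hf.contDiff) using 2 with x
  rw [linDeriv_mul (hf.contDiff.differentiable one_ne_zero x)
    (hg.contDiff.differentiable one_ne_zero x)]

lemma PuncturedSupport.sq {k : ℕ∞ω} {h : FourSpace → ℝ} (hh : PuncturedSupport k h) :
    PuncturedSupport k (fun x => h x ^ 2) := by
  simpa only [pow_two] using hh.mul hh.contDiff

lemma PuncturedSupport.frameEnergy {u : FourSpace → ℝ} (hu : PuncturedSupport 2 u) :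
    PuncturedSupport 1 (frameEnergy u) := by
  have h : ∀ A, PuncturedSupport 1 (_root_.linDeriv A u) := fun A => hu.linDeriv (by norm_num) A
  exact (((h _).sq.add (h _).sq).add (h _).sq).add (h _).sq

lemma PuncturedSupport.frameLaplacian_sq {u : FourSpace → ℝ} (hu : PuncturedSupport 2 u) :
    PuncturedSupport 0 (fun x => frameLaplacian u x ^ 2) := by
  have h : ∀ A, PuncturedSupport 1 (_root_.linDeriv A u) := fun A => hu.linDeriv (by norm_num) A
  have h2 : ∀ A B, PuncturedSupport 0 (_root_.linDeriv A (_root_.linDeriv B u)) := fun A B =>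
    (h B).linDeriv (by norm_num) A
  exact (((((h2 _ _).add (((h _).of_le (by norm_num)).mul contDiff_const)).add (h2 _ _)).add
    (h2 _ _)).add (h2 _ _)).sq

/-- The Hardy–Rellich inequality in the conformal frame. -/
theorem three_mul_integral_frameEnergy_le {u : FourSpace → ℝ} (hu : PuncturedSupport 2 u) :
    3 * ∫ x, dilationWeight x * frameEnergy u x
      ≤ ∫ x, dilationWeight x * frameLaplacian u x ^ 2 := by
  have h : ∀ A, PuncturedSupport 1 (linDeriv A u) := fun A => hu.linDeriv (by norm_num) A
  have hE := isConformalField_euler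
  have hI := isConformalField_leftI
  have hJ := isConformalField_leftJ
  have hK := isConformalField_leftK
  have cE : ∀ A : FourSpace →L[ℝ] FourSpace, ∀ x,
      linDeriv eulerField (linDeriv A u) x = linDeriv A (linDeriv eulerField u) x := fun A x =>
    sub_eq_zero.1 (by rw [linDeriv_comm hu.contDiff]; simp)
  have cIJ : ∀ x, linDeriv leftJ (linDeriv leftI u) x
      = linDeriv leftI (linDeriv leftJ u) x + 2 * linDeriv leftK u x := fun x => by
    have := linDeriv_comm (A := leftI) (B := leftJ) hu.contDiff x
    rw [leftJ_leftI_sub, map_smul, smul_eq_mul] at this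
    simp only [linDeriv] at this ⊢
    linarith
  have cJK : ∀ x, linDeriv leftK (linDeriv leftJ u) x
      = linDeriv leftJ (linDeriv leftK u) x + 2 * linDeriv leftI u x := fun x => by
    have := linDeriv_comm (A := leftJ) (B := leftK) hu.contDiff x
    rw [leftK_leftJ_sub, map_smul, smul_eq_mul] at this
    simp only [linDeriv] at this ⊢
    linarith
  have cKI : ∀ x, linDeriv leftI (linDeriv leftK u) x
      = linDeriv leftK (linDeriv leftI u) x + 2 * linDeriv leftJ u x := fun x => by
    have := linDeriv_comm (A := leftK) (B := leftI) hu.contDiff x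
    rw [leftI_leftK_sub, map_smul, smul_eq_mul] at this
    simp only [linDeriv] at this ⊢
    linarith
  have nE := (hE.leibniz (h eulerField) (h eulerField)).const_mul 2
  have nMixed : ∀ A, IsConformalField A → WeightedNull (fun x =>
      4 * (linDeriv A (linDeriv eulerField u) x * linDeriv A u x
        + linDeriv eulerField u x * linDeriv A (linDeriv A u) x)
      + -2 * (linDeriv eulerField (linDeriv A u) x * linDeriv A u x
        + linDeriv A u x * linDeriv eulerField (linDeriv A u) x)
      + 2 * (linDeriv eulerField (linDeriv eulerField u) x * linDeriv A (linDeriv A u) x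
        - linDeriv A (linDeriv eulerField u) x * linDeriv eulerField (linDeriv A u) x
        - linDeriv A u x * fderiv ℝ (linDeriv eulerField u) x (A x - A x))) := fun A hA =>
    (((hA.leibniz (h eulerField) (h A)).const_mul 4).add
      ((hE.leibniz (h A) (h A)).const_mul (-2))).add
      ((hE.sub_comm hA (h eulerField).contDiff (h eulerField).compact (h A)).const_mul 2)
  have nIJ := (hI.sub_comm hJ (h leftI).contDiff (h leftI).compact (h leftJ)).const_mul 3
  have nJK := (hJ.sub_comm hK (h leftJ).contDiff (h leftJ).compact (h leftK)).const_mul 3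
  have nKI := (hK.sub_comm hI (h leftK).contDiff (h leftK).compact (h leftI)).const_mul 3
  have nK := (hK.leibniz (h leftI) (h leftJ)).const_mul (-3)
  have nI := (hI.leibniz (h leftJ) (h leftK)).const_mul (-3)
  have nJ := (hJ.leibniz (h leftK) (h leftI)).const_mul (-3)
  have hN := ((((((((nE.add (nMixed _ hI)).add (nMixed _ hJ)).add (nMixed _ hK)).add
    nIJ).add nJK).add nKI).add nK).add nI).add nJ
  have hL := hu.frameLaplacian_sq.weighted.integrable
  have hG := hu.frameEnergy.weighted.integrable
  have e : ∀ x, dilationWeight x * frameLaplacian u x ^ 2 - 3 * (dilationWeight x * frameEnergy u x)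
      = dilationWeight x * (frameLaplacian u x ^ 2 - 3 * frameEnergy u x) := fun x => by ring
  have hLG := hL.sub (hG.const_mul 3)
  simp only [Pi.sub_def, e] at hLG
  rw [← sub_nonneg, ← integral_const_mul, ← integral_sub hL (hG.const_mul 3)]
  simp only [e]
  refine hN.integral_nonneg_of_le hLG fun x => ?_
  have dIJ : fderiv ℝ (linDeriv leftI u) x (leftJ (leftI x) - leftI (leftJ x))
      = -2 * linDeriv leftK (linDeriv leftI u) x := by
    rw [leftJ_leftI_sub, map_smul, smul_eq_mul, linDeriv]
  have dJK : fderiv ℝ (linDeriv leftJ u) x (leftK (leftJ x) - leftJ (leftK x))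
      = -2 * linDeriv leftI (linDeriv leftJ u) x := by
    rw [leftK_leftJ_sub, map_smul, smul_eq_mul, linDeriv]
  have dKI : fderiv ℝ (linDeriv leftK u) x (leftI (leftK x) - leftK (leftI x))
      = -2 * linDeriv leftJ (linDeriv leftK u) x := by
    rw [leftI_leftK_sub, map_smul, smul_eq_mul, linDeriv]
  rw [dIJ, dJK, dKI]
  simp only [sub_self, map_zero, cE leftI, cE leftJ, cE leftK, cIJ, cJK, cKI, frameLaplacian,
    frameEnergy]
  generalize linDeriv eulerField (linDeriv eulerField u) x = ee
  generalize linDeriv leftI (linDeriv eulerField u) x = d1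
  generalize linDeriv leftJ (linDeriv eulerField u) x = d2
  generalize linDeriv leftK (linDeriv eulerField u) x = d3
  generalize linDeriv eulerField u x = e
  generalize linDeriv leftI (linDeriv leftI u) x = a11
  generalize linDeriv leftJ (linDeriv leftJ u) x = a22
  generalize linDeriv leftK (linDeriv leftK u) x = a33
  generalize linDeriv leftI (linDeriv leftJ u) x = a12
  generalize linDeriv leftJ (linDeriv leftK u) x = a23
  generalize linDeriv leftK (linDeriv leftI u) x = a31
  generalize linDeriv leftI u x = b1
  generalize linDeriv leftJ u x = b2
  generalize linDeriv leftK u x = b3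
  rw [← sub_nonneg]
  have : 0 ≤ ee ^ 2 + e ^ 2 + 2 * (d1 ^ 2 + d2 ^ 2 + d3 ^ 2)
      + ((a11 - a22) ^ 2 + (a22 - a33) ^ 2 + (a33 - a11) ^ 2) / 2
      + 3 * ((a12 + b3) ^ 2 + (a23 + b1) ^ 2 + (a31 + b2) ^ 2) := by positivity
  refine this.trans_eq ?_
  ring

/-- Smooth functions with compact support in the open half-line. -/
structure HalfLineTest (f : ℝ → ℝ) : Prop where
  contDiff : ContDiff ℝ ∞ f
  compact : HasCompactSupport f
  tsupport_subset : tsupport f ⊆ Ioi 0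

namespace HalfLineTest

variable {f g : ℝ → ℝ}

lemma eq_zero (hf : HalfLineTest f) {t : ℝ} (ht : t ≤ 0) : f t = 0 :=
  image_eq_zero_of_notMem_tsupport fun h => absurd (hf.tsupport_subset h) (not_lt.2 ht)

lemma differentiable (hf : HalfLineTest f) : Differentiable ℝ f :=
  hf.contDiff.differentiable (by simp)

lemma deriv (hf : HalfLineTest f) : HalfLineTest (deriv f) :=
  ⟨(contDiff_infty_iff_deriv.1 hf.contDiff).2, hf.compact.deriv,
    tsupport_deriv_subset.trans hf.tsupport_subset⟩

lemma mul (hg : ContDiff ℝ ∞ g) (hf : HalfLineTest f) : HalfLineTest (fun t => g t * f t) :=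
  ⟨hg.mul hf.contDiff, hf.compact.mul_left, tsupport_mul_subset_right.trans hf.tsupport_subset⟩

lemma add (hf : HalfLineTest f) (hg : HalfLineTest g) : HalfLineTest (fun t => f t + g t) :=
  ⟨hf.contDiff.add hg.contDiff, hf.compact.add hg.compact,
    (tsupport_add f g).trans (union_subset hf.tsupport_subset hg.tsupport_subset)⟩

lemma puncturedSupport (hf : HalfLineTest f) :
    PuncturedSupport ∞ (fun x => f (Real.log ‖x‖)) := by
  have h0 : ∀ᶠ x : FourSpace in 𝓝 0, f (Real.log ‖x‖) = 0 := by
    filter_upwards [ball_mem_nhds (0 : FourSpace) one_pos] with x hx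
    exact hf.eq_zero (Real.log_nonpos (norm_nonneg x) (mem_ball_zero_iff.1 hx).le)
  refine ⟨contDiff_iff_contDiffAt.2 fun x => ?_, ?_, notMem_tsupport_iff_eventuallyEq.2 h0⟩
  · by_cases hx : x = 0
    · subst hx
      exact (contDiffAt_const (c := (0 : ℝ))).congr_of_eventuallyEq h0
    · exact hf.contDiff.contDiffAt.comp x
        ((contDiffAt_norm ℝ hx).log (norm_ne_zero_iff.2 hx))
  · obtain ⟨R, hR⟩ := hf.compact.isCompact.isBounded.subset_closedBall 0
    refine HasCompactSupport.intro (isCompact_closedBall (0 : FourSpace) (Real.exp R))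
      fun x hx => image_eq_zero_of_notMem_tsupport fun h => hx ?_
    have h1 := (le_abs_self _).trans (mem_closedBall_zero_iff.1 (hR h))
    rw [mem_closedBall_zero_iff]
    rcases (norm_nonneg x).eq_or_lt with hn | hn
    · rw [← hn]; positivity
    · exact (Real.log_le_iff_le_exp hn).1 h1

end HalfLineTest

/-- The product of a linear form with a function of `log |x|`. -/
noncomputable def linearRadial (m : FourSpace →L[ℝ] ℝ) (f : ℝ → ℝ) (x : FourSpace) : ℝ :=
  m x * f (Real.log ‖x‖)

lemma HalfLineTest.linearRadial {f : ℝ → ℝ} (hf : HalfLineTest f) (m : FourSpace →L[ℝ] ℝ) :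
    PuncturedSupport ∞ (linearRadial m f) :=
  hf.puncturedSupport.mul m.contDiff

lemma linDeriv_linearRadial {f : ℝ → ℝ} (hf : HalfLineTest f) (m : FourSpace →L[ℝ] ℝ)
    (A : FourSpace →L[ℝ] FourSpace) {x : FourSpace} (hx : x ≠ 0) :
    linDeriv A (linearRadial m f) x = m (A x) * f (Real.log ‖x‖)
      + m x * (deriv f (Real.log ‖x‖) * (inner ℝ x (A x) / ‖x‖ ^ 2)) := by
  have hn : ‖x‖ ≠ 0 := norm_ne_zero_iff.2 hx
  have h1 := hasFDerivAt_norm_sq x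
  have h2 : HasFDerivAt (fun y : FourSpace => Real.log ‖y‖) ((‖x‖ ^ 2)⁻¹ • innerSL ℝ x) x := by
    have h := (h1.log (pow_ne_zero 2 hn)).const_mul (2⁻¹ : ℝ)
    refine (h.congr_fderiv ?_).congr_of_eventuallyEq (Eventually.of_forall fun y => ?_)
    · rw [smul_smul, smul_smul]
      congr 1
      ring
    · simp [Real.log_pow]
  have h3 := (hf.differentiable (Real.log ‖x‖)).hasDerivAt.comp_hasFDerivAt x h2
  have h4 := m.hasFDerivAt (x := x) |>.mul h3
  have h5 : HasFDerivAt (linearRadial m f) _ x := h4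
  rw [linDeriv, h5.fderiv]
  simp [div_eq_inv_mul]
  ring

lemma linDeriv_euler_linearRadial {f : ℝ → ℝ} (hf : HalfLineTest f) (m : FourSpace →L[ℝ] ℝ) :
    linDeriv eulerField (linearRadial m f) = linearRadial m (fun t => f t + deriv f t) := by
  ext x
  by_cases hx : x = 0
  · simp [hx, linDeriv, linearRadial]
  · have hn : ‖x‖ ≠ 0 := norm_ne_zero_iff.2 hx
    rw [linDeriv_linearRadial hf m _ hx]
    simp [linearRadial, hn]
    ring

lemma linDeriv_rotation_linearRadial {f : ℝ → ℝ} (hf : HalfLineTest f) (m : FourSpace →L[ℝ] ℝ)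
    {A : FourSpace →L[ℝ] FourSpace} (hA : ∀ x, inner ℝ x (A x) = 0) :
    linDeriv A (linearRadial m f) = linearRadial (m.comp A) f := by
  ext x
  by_cases hx : x = 0
  · simp [hx, linDeriv, linearRadial]
  · rw [linDeriv_linearRadial hf m _ hx, hA]
    simp [linearRadial]

/-- The first coordinate. -/
noncomputable abbrev coordZero : FourSpace →L[ℝ] ℝ := EuclideanSpace.proj 0

/-- The function `x₀ / |x|` times `f (log |x|)`. -/
noncomputable def sphericalTest (f : ℝ → ℝ) : FourSpace → ℝ :=
  linearRadial coordZero (fun t => Real.exp (-t) * f t)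

lemma HalfLineTest.sphericalTest {f : ℝ → ℝ} (hf : HalfLineTest f) :
    PuncturedSupport ∞ (sphericalTest f) :=
  (hf.mul (by fun_prop)).linearRadial _

lemma deriv_exp_mul {f : ℝ → ℝ} (hf : HalfLineTest f) (c t : ℝ) :
    deriv (fun s => Real.exp (c * s) * f s) t = Real.exp (c * t) * (c * f t + deriv f t) := by
  have h1 : HasDerivAt (fun s => Real.exp (c * s)) (Real.exp (c * t) * c) t := by
    simpa using ((hasDerivAt_id t).const_mul c).exp
  have h2 := (h1.mul (hf.differentiable t).hasDerivAt).deriv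
  refine Eq.trans ?_ (h2.trans (by ring))
  rfl

lemma linDeriv_euler_sphericalTest {f : ℝ → ℝ} (hf : HalfLineTest f) :
    linDeriv eulerField (sphericalTest f) = sphericalTest (deriv f) := by
  have h := deriv_exp_mul hf (-1)
  simp only [neg_one_mul] at h
  rw [sphericalTest, linDeriv_euler_linearRadial (hf.mul (by fun_prop))]
  simp only [h, sphericalTest]
  congr 1
  ext t
  ring

lemma linDeriv_linDeriv_sphericalTest {f : ℝ → ℝ} (hf : HalfLineTest f)
    {A : FourSpace →L[ℝ] FourSpace} (hA : ∀ x, inner ℝ x (A x) = 0) (hAA : ∀ x, A (A x) = -x)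
    (x : FourSpace) :
    linDeriv A (linDeriv A (sphericalTest f)) x = -sphericalTest f x := by
  have hF : HalfLineTest (fun t => Real.exp (-t) * f t) := hf.mul (by fun_prop)
  rw [sphericalTest, linDeriv_rotation_linearRadial hF _ hA,
    linDeriv_rotation_linearRadial hF _ hA]
  simp [linearRadial, hAA]

lemma exp_neg_log_norm_sq {x : FourSpace} (hx : x ≠ 0) :
    Real.exp (-Real.log ‖x‖) ^ 2 = (‖x‖ ^ 2)⁻¹ := by
  rw [Real.exp_neg, Real.exp_log (norm_pos_iff.2 hx), inv_pow]

/-- The square of `x₀ / |x|`. -/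
noncomputable def coordRatioSq (x : FourSpace) : ℝ := x 0 ^ 2 / ‖x‖ ^ 2

lemma coordRatioSq_nonneg (x : FourSpace) : 0 ≤ coordRatioSq x := by
  unfold coordRatioSq; positivity

lemma coordRatioSq_le_one (x : FourSpace) : coordRatioSq x ≤ 1 := by
  refine div_le_one_of_le₀ ?_ (by positivity)
  rw [EuclideanSpace.norm_sq_eq, Fin.sum_univ_four]
  simp only [Real.norm_eq_abs, sq_abs]
  nlinarith [sq_nonneg (x 1), sq_nonneg (x 2), sq_nonneg (x 3)]

lemma frameLaplacian_sphericalTest_sq {f : ℝ → ℝ} (hf : HalfLineTest f) (x : FourSpace) :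
    frameLaplacian (sphericalTest f) x ^ 2 = coordRatioSq x *
      (deriv (deriv f) (Real.log ‖x‖) + 2 * deriv f (Real.log ‖x‖) - 3 * f (Real.log ‖x‖)) ^ 2 := by
  rw [frameLaplacian, linDeriv_euler_sphericalTest hf, linDeriv_euler_sphericalTest hf.deriv,
    linDeriv_linDeriv_sphericalTest hf inner_leftI leftI_leftI,
    linDeriv_linDeriv_sphericalTest hf inner_leftJ leftJ_leftJ,
    linDeriv_linDeriv_sphericalTest hf inner_leftK leftK_leftK]
  by_cases hx : x = 0
  · simp [hx, sphericalTest, linearRadial, coordRatioSq]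
  · rw [coordRatioSq, div_eq_mul_inv, ← exp_neg_log_norm_sq hx]
    simp only [sphericalTest, linearRadial, PiLp.proj_apply]
    ring

lemma sum_sq_rotations (x : FourSpace) :
    (leftI x) 0 ^ 2 + (leftJ x) 0 ^ 2 + (leftK x) 0 ^ 2 = ‖x‖ ^ 2 - x 0 ^ 2 := by
  simp [EuclideanSpace.norm_sq_eq, Fin.sum_univ_four, leftI_apply, leftJ_apply, leftK_apply]
  ring

lemma frameEnergy_sphericalTest {f : ℝ → ℝ} (hf : HalfLineTest f) (x : FourSpace) :
    frameEnergy (sphericalTest f) x = coordRatioSq x * deriv f (Real.log ‖x‖) ^ 2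
      + (1 - coordRatioSq x) * f (Real.log ‖x‖) ^ 2 := by
  have hF : HalfLineTest (fun t => Real.exp (-t) * f t) := hf.mul (by fun_prop)
  rw [frameEnergy, linDeriv_euler_sphericalTest hf]
  simp only [sphericalTest]
  rw [linDeriv_rotation_linearRadial hF _ inner_leftI,
    linDeriv_rotation_linearRadial hF _ inner_leftJ,
    linDeriv_rotation_linearRadial hF _ inner_leftK]
  by_cases hx : x = 0
  · simp [hx, linearRadial, hf.eq_zero le_rfl, hf.deriv.eq_zero le_rfl]
  · have h1 : coordRatioSq x = x 0 ^ 2 * Real.exp (-Real.log ‖x‖) ^ 2 := by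
      rw [coordRatioSq, div_eq_mul_inv, exp_neg_log_norm_sq hx]
    have h2 : 1 - coordRatioSq x = ((leftI x) 0 ^ 2 + (leftJ x) 0 ^ 2 + (leftK x) 0 ^ 2)
        * Real.exp (-Real.log ‖x‖) ^ 2 := by
      have hn : ‖x‖ ≠ 0 := norm_ne_zero_iff.2 hx
      rw [exp_neg_log_norm_sq hx, sum_sq_rotations, coordRatioSq]
      field_simp
    rw [h2, h1]
    simp only [linearRadial, PiLp.proj_apply, ContinuousLinearMap.comp_apply]
    ring

lemma weightedNull_radial {g : ℝ → ℝ} (hg : HalfLineTest g) :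
    WeightedNull (fun x => coordRatioSq x * deriv g (Real.log ‖x‖)) := by
  have hQ : HalfLineTest (fun t => Real.exp (-2 * t) * g t) := hg.mul (by fun_prop)
  have hU := hQ.linearRadial coordZero
  convert isConformalField_euler _ ((hU.mul coordZero.contDiff).of_le (by simp)) using 2 with x
  rw [linDeriv_mul coordZero.differentiableAt (hU.contDiff.differentiable (by simp) x),
    linDeriv_euler_linearRadial hQ]
  simp only [linDeriv, ContinuousLinearMap.fderiv, linearRadial, deriv_exp_mul hg]
  by_cases hx : x = 0
  · simp [hx, coordRatioSq]
  · rw [coordRatioSq, div_eq_mul_inv, ← exp_neg_log_norm_sq hx, ← Real.exp_nat_mul]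
    simp only [ContinuousLinearMap.id_apply, PiLp.proj_apply]
    push_cast
    ring_nf

lemma weightedNull_angular {g : ℝ → ℝ} (hg : HalfLineTest g) :
    WeightedNull (fun x => (1 - 4 * coordRatioSq x) * g (Real.log ‖x‖)) := by
  have hQ : HalfLineTest (fun t => Real.exp (-2 * t) * g t) := hg.mul (by fun_prop)
  have hU := hQ.linearRadial coordZero
  have hA : ∀ A : FourSpace →L[ℝ] FourSpace, IsConformalField A → (∀ x, inner ℝ x (A x) = 0) →
      (∀ x, A (A x) = -x) → WeightedNull (fun x => (A x 0 ^ 2 - x 0 ^ 2) *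
        (Real.exp (-2 * Real.log ‖x‖) * g (Real.log ‖x‖))) := by
    intro A hc hA hAA
    convert hc _ ((hU.mul (coordZero.comp A).contDiff).of_le (by simp)) using 2 with x
    rw [linDeriv_mul (coordZero.comp A).differentiableAt (hU.contDiff.differentiable (by simp) x),
      linDeriv_rotation_linearRadial hQ _ hA]
    simp only [linDeriv, ContinuousLinearMap.fderiv, linearRadial, ContinuousLinearMap.comp_apply,
      hAA, PiLp.proj_apply, PiLp.neg_apply]
    ring
  convert ((hA _ isConformalField_leftI inner_leftI leftI_leftI).add
    (hA _ isConformalField_leftJ inner_leftJ leftJ_leftJ)).add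
    (hA _ isConformalField_leftK inner_leftK leftK_leftK) using 2 with x
  by_cases hx : x = 0
  · simp [hx, hg.eq_zero le_rfl]
  · have hn : ‖x‖ ≠ 0 := norm_ne_zero_iff.2 hx
    have hs := sum_sq_rotations x
    have he : Real.exp (-2 * Real.log ‖x‖) = (‖x‖ ^ 2)⁻¹ := by
      rw [← exp_neg_log_norm_sq hx, ← Real.exp_nat_mul]
      push_cast
      ring_nf
    rw [← add_mul, ← add_mul, he, show (leftI x) 0 ^ 2 - x 0 ^ 2 + ((leftJ x) 0 ^ 2 - x 0 ^ 2)
      + ((leftK x) 0 ^ 2 - x 0 ^ 2) = ‖x‖ ^ 2 - 4 * x 0 ^ 2 by linarith, coordRatioSq]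
    field_simp

/-- The integral of `g (log |x|)` for the measure `|x|⁻⁴ dx`. -/
noncomputable def radialIntegral (g : ℝ → ℝ) : ℝ :=
  ∫ x : FourSpace, dilationWeight x * g (Real.log ‖x‖)

lemma radialIntegral_comp_mul_left (g : ℝ → ℝ) {ε : ℝ} (hε : 0 < ε) :
    radialIntegral (fun t => g (ε * t)) = ε⁻¹ * radialIntegral g := by
  have h1 : ∀ k : ℝ → ℝ, radialIntegral k
      = 4 * (volume.real (ball (0 : FourSpace) 1) * ∫ y in Ioi 0, y⁻¹ * k (Real.log y)) := by
    intro k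
    have h := integral_fun_norm_addHaar (volume : Measure FourSpace)
      fun r => (r ^ 4)⁻¹ * k (Real.log r)
    refine h.trans ?_
    simp only [finrank_euclideanSpace, Fintype.card_fin, nsmul_eq_mul, smul_eq_mul]
    push_cast
    congr 2
    refine setIntegral_congr_fun measurableSet_Ioi fun y hy => ?_
    have hy0 : y ≠ 0 := (mem_Ioi.1 hy).ne'
    field_simp
  have h2 : ∫ y in Ioi 0, y⁻¹ * g (Real.log y)
      = ε * ∫ y in Ioi 0, y⁻¹ * g (ε * Real.log y) := by
    rw [← integral_comp_rpow_Ioi_of_pos hε, ← integral_const_mul]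
    refine setIntegral_congr_fun measurableSet_Ioi fun y hy => ?_
    have hy0 : 0 < y := hy
    have : y ^ ε ≠ 0 := (Real.rpow_pos_of_pos hy0 ε).ne'
    simp only [Real.log_rpow hy0, Real.rpow_sub_one hy0.ne', smul_eq_mul]
    field_simp
  rw [h1, h1, h2]
  field_simp

namespace HalfLineTest

variable {f : ℝ → ℝ}

lemma sq (hf : HalfLineTest f) : HalfLineTest (fun t => f t ^ 2) := by
  simpa only [pow_two] using hf.mul hf.contDiff

lemma integrable (hf : HalfLineTest f) :
    Integrable (fun x : FourSpace => dilationWeight x * f (Real.log ‖x‖)) :=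
  hf.puncturedSupport.weighted.integrable

lemma radialIntegral_sq_pos (hf : HalfLineTest f) {t : ℝ} (ht : f t ≠ 0) :
    0 < radialIntegral (fun t => f t ^ 2) := by
  have h := hf.sq.puncturedSupport.weighted
  refine h.contDiff.continuous.integral_pos_of_hasCompactSupport_nonneg_nonzero h.compact
    (x := EuclideanSpace.single 0 (Real.exp t))
    (fun x => mul_nonneg (dilationWeight_nonneg x) (sq_nonneg _)) ?_
  simp [dilationWeight, ht]

lemma comp_mul_left (hf : HalfLineTest f) {ε : ℝ} (hε : 0 < ε) :
    HalfLineTest (fun t => f (ε * t)) := by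
  refine ⟨hf.contDiff.comp (by fun_prop),
    by simpa only [smul_eq_mul] using hf.compact.comp_smul hε.ne', fun t ht => ?_⟩
  have h : ε * t ∈ tsupport f :=
    tsupport_comp_subset_preimage f (f := fun s => ε * s) (by fun_prop) ht
  exact (mul_pos_iff_of_pos_left hε).1 (hf.tsupport_subset h)

lemma integral_frameLaplacian_sphericalTest_sub_le (hf : HalfLineTest f) :
    (∫ x, dilationWeight x * frameLaplacian (_root_.sphericalTest f) x ^ 2)
      - 3 * (∫ x, dilationWeight x * frameEnergy (_root_.sphericalTest f) x)
      ≤ radialIntegral (fun t => _root_.deriv (_root_.deriv f) t ^ 2)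
        + 7 * radialIntegral (fun t => _root_.deriv f t ^ 2) := by
  have hu := hf.sphericalTest
  let G : ℝ → ℝ := fun t => (2 * _root_.deriv f t) * _root_.deriv f t
    + ((-6 * f t) * f t + (-6 * f t) * _root_.deriv f t)
  have hG : HalfLineTest G := (hf.deriv.mul (contDiff_const.mul hf.deriv.contDiff)).add
    ((hf.mul (contDiff_const.mul hf.contDiff)).add (hf.deriv.mul (contDiff_const.mul hf.contDiff)))
  have hG' : ∀ t, _root_.deriv G t = 4 * _root_.deriv f t * _root_.deriv (_root_.deriv f) t
      - 12 * f t * _root_.deriv f t - 6 * _root_.deriv f t ^ 2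
      - 6 * f t * _root_.deriv (_root_.deriv f) t := by
    intro t
    have h0 := (hf.differentiable t).hasDerivAt
    have h1 := (hf.deriv.differentiable t).hasDerivAt
    have h := ((h1.const_mul 2).mul h1).add
      (((h0.const_mul (-6)).mul h0).add ((h0.const_mul (-6)).mul h1))
    refine Eq.trans ?_ (h.deriv.trans (by ring))
    rfl
  have i1 := (hu.of_le (l := 2) ENat.LEInfty.out).frameLaplacian_sq.weighted.integrable
  have i2 := (hu.of_le (l := 2) ENat.LEInfty.out).frameEnergy.weighted.integrable
  have i3 := hf.deriv.deriv.sq.integrable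
  have i4 := hf.deriv.sq.integrable
  have i5 : Integrable (fun x => dilationWeight x * _root_.deriv (_root_.deriv f) (Real.log ‖x‖) ^ 2
      + 7 * (dilationWeight x * _root_.deriv f (Real.log ‖x‖) ^ 2)) := i3.add (i4.const_mul 7)
  have i6 : Integrable (fun x => dilationWeight x * frameLaplacian (_root_.sphericalTest f) x ^ 2
      - 3 * (dilationWeight x * frameEnergy (_root_.sphericalTest f) x)) := i1.sub (i2.const_mul 3)
  have e : ∀ x, dilationWeight x * (_root_.deriv (_root_.deriv f) (Real.log ‖x‖) ^ 2
      + 7 * _root_.deriv f (Real.log ‖x‖) ^ 2 - (frameLaplacian (_root_.sphericalTest f) x ^ 2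
        - 3 * frameEnergy (_root_.sphericalTest f) x))
      = (dilationWeight x * _root_.deriv (_root_.deriv f) (Real.log ‖x‖) ^ 2
      + 7 * (dilationWeight x * _root_.deriv f (Real.log ‖x‖) ^ 2))
      - (dilationWeight x * frameLaplacian (_root_.sphericalTest f) x ^ 2
        - 3 * (dilationWeight x * frameEnergy (_root_.sphericalTest f) x)) := fun x => by ring
  have key := (((weightedNull_angular hf.sq).const_mul 3).sub
    (weightedNull_radial hG)).integral_nonneg_of_le
    (g := fun x => _root_.deriv (_root_.deriv f) (Real.log ‖x‖) ^ 2
      + 7 * _root_.deriv f (Real.log ‖x‖) ^ 2 - (frameLaplacian (_root_.sphericalTest f) x ^ 2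
        - 3 * frameEnergy (_root_.sphericalTest f) x))
    (by simp only [e]; exact i5.sub i6) fun x => by
      rw [frameLaplacian_sphericalTest_sq hf, frameEnergy_sphericalTest hf, hG']
      have h := mul_nonneg (sub_nonneg.2 (coordRatioSq_le_one x))
        (by positivity : 0 ≤ _root_.deriv (_root_.deriv f) (Real.log ‖x‖) ^ 2
          + 7 * _root_.deriv f (Real.log ‖x‖) ^ 2)
      linarith
  simp only [e] at key
  rw [integral_sub i5 i6, integral_add i3 (i4.const_mul 7), integral_sub i1 (i2.const_mul 3),
    integral_const_mul, integral_const_mul] at key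
  unfold radialIntegral
  linarith

lemma le_integral_frameEnergy_sphericalTest (hf : HalfLineTest f) :
    3 / 4 * radialIntegral (fun t => f t ^ 2)
      ≤ ∫ x, dilationWeight x * frameEnergy (_root_.sphericalTest f) x := by
  have i1 := (hf.sphericalTest.of_le (l := 2) ENat.LEInfty.out).frameEnergy.weighted.integrable
  have i2 := hf.sq.integrable
  have e : ∀ x, dilationWeight x * (frameEnergy (_root_.sphericalTest f) x
      - 3 / 4 * f (Real.log ‖x‖) ^ 2) = dilationWeight x * frameEnergy (_root_.sphericalTest f) x
      - 3 / 4 * (dilationWeight x * f (Real.log ‖x‖) ^ 2) := fun x => by ring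
  have key := ((weightedNull_angular hf.sq).const_mul (1 / 4)).integral_nonneg_of_le
    (g := fun x => frameEnergy (_root_.sphericalTest f) x - 3 / 4 * f (Real.log ‖x‖) ^ 2)
    (by simp only [e]; exact i1.sub (i2.const_mul _)) fun x => by
      rw [frameEnergy_sphericalTest hf]
      have h := mul_nonneg (coordRatioSq_nonneg x) (sq_nonneg (_root_.deriv f (Real.log ‖x‖)))
      linarith
  simp only [e] at key
  rw [integral_sub i1 (i2.const_mul _), integral_const_mul] at key
  unfold radialIntegral
  linarith

end HalfLineTest

lemma exists_halfLineTest : ∃ f : ℝ → ℝ, HalfLineTest f ∧ f 2 ≠ 0 := by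
  let φ : ContDiffBump (2 : ℝ) := ⟨1 / 2, 1, by norm_num, by norm_num⟩
  refine ⟨φ, ⟨φ.contDiff, φ.hasCompactSupport, ?_⟩, ?_⟩
  · rw [φ.tsupport_eq, Real.closedBall_eq_Icc]
    exact fun t ht => mem_Ioi.2 (lt_of_lt_of_le (by norm_num [φ]) ht.1)
  · rw [φ.one_of_mem_closedBall (mem_closedBall_self φ.rIn_pos.le)]
    exact one_ne_zero

/-- The constant `3` cannot be improved. -/
lemma exists_integral_frameLaplacian_lt {w : ℝ} (hw : 3 < w) :
    ∃ u : FourSpace → ℝ, PuncturedSupport ∞ u ∧ 0 < ∫ x, dilationWeight x * frameEnergy u x ∧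
      ∫ x, dilationWeight x * frameLaplacian u x ^ 2
        < w * ∫ x, dilationWeight x * frameEnergy u x := by
  obtain ⟨f, hf, h2⟩ := exists_halfLineTest
  have hc := hf.radialIntegral_sq_pos h2
  set a := radialIntegral (fun t => deriv (deriv f) t ^ 2) with ha
  set b := radialIntegral (fun t => deriv f t ^ 2) with hb
  set c := radialIntegral (fun t => f t ^ 2)
  have hlim : Tendsto (fun ε : ℝ => ε ^ 4 * a + 7 * ε ^ 2 * b) (𝓝[>] 0) (𝓝 0) := by
    refine tendsto_nhdsWithin_of_tendsto_nhds ?_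
    have : Continuous (fun ε : ℝ => ε ^ 4 * a + 7 * ε ^ 2 * b) := by fun_prop
    simpa using this.tendsto 0
  obtain ⟨ε, hε, hlt⟩ := (eventually_mem_nhdsWithin.and (hlim.eventually_lt_const
    (show 0 < (w - 3) * (3 / 4 * c) by nlinarith))).exists
  have hε : 0 < ε := hε
  have hF := hf.comp_mul_left hε
  have d1 : deriv (fun t => f (ε * t)) = fun t => ε * deriv f (ε * t) :=
    funext fun t => deriv_comp_mul_left ε f t
  have d2 : deriv (deriv (fun t => f (ε * t))) = fun t => ε ^ 2 * deriv (deriv f) (ε * t) := by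
    ext t
    rw [d1, deriv_const_mul_field, deriv_comp_mul_left, smul_eq_mul]
    ring
  have num := hF.integral_frameLaplacian_sphericalTest_sub_le
  have den := hF.le_integral_frameEnergy_sphericalTest
  rw [d2, d1] at num
  have r : ∀ (k : ℝ → ℝ) (s : ℝ), radialIntegral (fun t => (s * k (ε * t)) ^ 2)
      = s ^ 2 * (ε⁻¹ * radialIntegral (fun t => k t ^ 2)) := by
    intro k s
    rw [← radialIntegral_comp_mul_left _ hε, radialIntegral, radialIntegral, ← integral_const_mul]
    congr 1 with x
    ring
  rw [r, r, ← ha, ← hb] at num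
  rw [radialIntegral_comp_mul_left (fun t => f t ^ 2) hε] at den
  have hi := inv_pos.2 hε
  have hlt' := mul_lt_mul_of_pos_left hlt hi
  refine ⟨_, hF.sphericalTest, lt_of_lt_of_le (by positivity) den, ?_⟩
  have := mul_le_mul_of_nonneg_left den (sub_pos.2 hw).le
  linarith

lemma integral_lap_sq_eq {u : FourSpace → ℝ} (hu : PuncturedSupport 2 u) :
    ∫ x, lap u x ^ 2 = ∫ x, dilationWeight x * frameLaplacian u x ^ 2 :=
  integral_congr_ae (Eventually.of_forall (integrand_lap_eq hu))

lemma integral_gradient_eq {u : FourSpace → ℝ} :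
    ∫ x, ‖x‖ ^ (-2 : ℝ) * ‖gradient u x‖ ^ 2 = ∫ x, dilationWeight x * frameEnergy u x :=
  integral_congr_ae (Eventually.of_forall integrand_gradient_eq)

theorem statement7 :
    sInf {r : ℝ | ∃ u : EuclideanSpace ℝ (Fin 4) → ℝ,
        ContDiff ℝ 2 u ∧ HasCompactSupport u ∧
        (0 : EuclideanSpace ℝ (Fin 4)) ∉ tsupport u ∧
        (∫ x : EuclideanSpace ℝ (Fin 4), ‖x‖ ^ (-2 : ℝ) * ‖gradient u x‖ ^ 2) ≠ 0 ∧
        r = (∫ x : EuclideanSpace ℝ (Fin 4), (lap u x) ^ 2) /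
            (∫ x : EuclideanSpace ℝ (Fin 4), ‖x‖ ^ (-2 : ℝ) * ‖gradient u x‖ ^ 2)} =
      3 := by
  have hex : ∀ w : ℝ, 3 < w → ∃ u : FourSpace → ℝ, PuncturedSupport 2 u ∧
      (∫ x, ‖x‖ ^ (-2 : ℝ) * ‖gradient u x‖ ^ 2) ≠ 0 ∧
      (∫ x, lap u x ^ 2) / (∫ x, ‖x‖ ^ (-2 : ℝ) * ‖gradient u x‖ ^ 2) < w := by
    intro w hw
    obtain ⟨u, hu, hpos, hlt⟩ := exists_integral_frameLaplacian_lt hw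
    have hu2 : PuncturedSupport 2 u := hu.of_le ENat.LEInfty.out
    refine ⟨u, hu2, ?_, ?_⟩
    · rw [integral_gradient_eq]
      exact hpos.ne'
    · rwa [integral_lap_sq_eq hu2, integral_gradient_eq, div_lt_iff₀ hpos]
  refine csInf_eq_of_forall_ge_of_forall_gt_exists_lt ?_ ?_ ?_
  · obtain ⟨u, hu, hne, -⟩ := hex 4 (by norm_num)
    exact ⟨_, u, hu.contDiff, hu.compact, hu.zero_notMem, hne, rfl⟩
  · rintro _ ⟨u, h1, h2, h3, hne, rfl⟩
    have hu : PuncturedSupport 2 u := ⟨h1, h2, h3⟩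
    have hpos := (integral_nonneg fun x : FourSpace => (by positivity :
      0 ≤ ‖x‖ ^ (-2 : ℝ) * ‖gradient u x‖ ^ 2)).lt_of_ne' hne
    rw [le_div_iff₀ hpos, integral_lap_sq_eq hu, integral_gradient_eq]
    exact three_mul_integral_frameEnergy_le hu
  · intro w hw
    obtain ⟨u, hu, hne, hlt⟩ := hex w hw
    exact ⟨_, ⟨u, hu.contDiff, hu.compact, hu.zero_notMem, hne, rfl⟩, hlt⟩
end

section
/- For every ε > 0 there exists a function u : ℝ² → ℝ of class C² with compact support contained in ℝ² \ {0} such that ∫_{ℝ²} |x|^{-2} |∇u(x)|² dx ≠ 0 and ∫_{ℝ²} |Δu(x)|² dx < ε ∫_{ℝ²} |x|^{-2} |∇u(x)|² dx. (That is, in dimension n = 2 and for α = 0 the best constant δ_{2,0} equals 0.) -/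
open MeasureTheory

open Set Filter Topology

lemma ioc_indicator_integrand_eq {a b : ℝ} (ha : 0 < a) (y : ℝ) :
    (Ioi (0 : ℝ)).indicator
        (fun y : ℝ ↦ y ^ (2 - 1) • (Ioc a b).indicator (fun r : ℝ ↦ r ^ (-2 : ℝ)) y) y =
      (Ioc a b).indicator (fun r : ℝ ↦ r⁻¹) y := by
  by_cases hy : y ∈ Ioc a b
  · have h0 : 0 < y := ha.trans hy.1
    rw [indicator_of_mem (mem_Ioi.2 h0), indicator_of_mem hy, indicator_of_mem hy,
      Real.rpow_neg h0.le, Real.rpow_two]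
    simp only [smul_eq_mul]
    field_simp
    norm_num
  · simp [indicator_of_notMem hy]

lemma integrable_annulus_norm_rpow_neg_two {a b : ℝ} (ha : 0 < a) :
    Integrable (fun x : EuclideanSpace ℝ (Fin 2) ↦
      (Ioc a b).indicator (fun r : ℝ ↦ r ^ (-2 : ℝ)) ‖x‖) := by
  rw [integrable_fun_norm_addHaar volume (f := (Ioc a b).indicator fun r : ℝ ↦ r ^ (-2 : ℝ)),
    ← integrable_indicator_iff measurableSet_Ioi, finrank_euclideanSpace, Fintype.card_fin,
    funext (ioc_indicator_integrand_eq (b := b) ha), integrable_indicator_iff measurableSet_Ioc]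
  refine (ContinuousOn.integrableOn_Icc (μ := volume) ?_).mono_set Ioc_subset_Icc_self
  exact continuousOn_inv₀.mono fun x hx ↦ (ha.trans_le hx.1).ne'

lemma integral_annulus_norm_rpow_neg_two {a b : ℝ} (ha : 0 < a) (hab : a ≤ b) :
    ∫ x : EuclideanSpace ℝ (Fin 2), (Ioc a b).indicator (fun r : ℝ ↦ r ^ (-2 : ℝ)) ‖x‖ =
      2 * volume.real (Metric.ball (0 : EuclideanSpace ℝ (Fin 2)) 1) * Real.log (b / a) := by
  rw [integral_fun_norm_addHaar volume ((Ioc a b).indicator fun r : ℝ ↦ r ^ (-2 : ℝ)),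
    ← integral_indicator measurableSet_Ioi, finrank_euclideanSpace, Fintype.card_fin,
    funext (ioc_indicator_integrand_eq (b := b) ha), integral_indicator measurableSet_Ioc,
    ← intervalIntegral.integral_of_le hab, integral_inv_of_pos ha (ha.trans_le hab)]
  simp [mul_assoc]

/-- A degree-one harmonic modulated by a profile in logarithmic radial coordinates. -/
noncomputable def logProfile (φ : ℝ → ℝ) (δ : ℝ) (x : EuclideanSpace ℝ (Fin 2)) : ℝ :=
  x 0 * φ (δ * Real.log (x 0 ^ 2 + x 1 ^ 2))

lemma sq_add_sq_eq_norm_sq (x : EuclideanSpace ℝ (Fin 2)) : x 0 ^ 2 + x 1 ^ 2 = ‖x‖ ^ 2 := by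
  rw [EuclideanSpace.real_norm_sq_eq, Fin.sum_univ_two]

lemma sq_add_sq_pos {x : EuclideanSpace ℝ (Fin 2)} (hx : x ≠ 0) : 0 < x 0 ^ 2 + x 1 ^ 2 := by
  rw [sq_add_sq_eq_norm_sq]
  positivity

lemma hasFDerivAt_coord (i : Fin 2) (x : EuclideanSpace ℝ (Fin 2)) :
    HasFDerivAt (fun y : EuclideanSpace ℝ (Fin 2) ↦ y i) (EuclideanSpace.proj (𝕜 := ℝ) i) x :=
  (EuclideanSpace.proj (𝕜 := ℝ) i : EuclideanSpace ℝ (Fin 2) →L[ℝ] ℝ).hasFDerivAt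

lemma hasFDerivAt_sq_add_sq (x : EuclideanSpace ℝ (Fin 2)) :
    HasFDerivAt (fun y : EuclideanSpace ℝ (Fin 2) ↦ y 0 ^ 2 + y 1 ^ 2)
      ((2 * x 0) • EuclideanSpace.proj (𝕜 := ℝ) (0 : Fin 2) +
        (2 * x 1) • EuclideanSpace.proj (𝕜 := ℝ) (1 : Fin 2)) x := by
  refine (((hasFDerivAt_coord 0 x).pow 2).add
    ((hasFDerivAt_coord 1 x).pow 2)).congr_fderiv ?_
  simp

lemma hasFDerivAt_comp_log {φ : ℝ → ℝ} (hφ : Differentiable ℝ φ) (δ : ℝ)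
    {x : EuclideanSpace ℝ (Fin 2)} (hx : x ≠ 0) :
    HasFDerivAt (fun y : EuclideanSpace ℝ (Fin 2) ↦ φ (δ * Real.log (y 0 ^ 2 + y 1 ^ 2)))
      (deriv φ (δ * Real.log (x 0 ^ 2 + x 1 ^ 2)) • δ • (x 0 ^ 2 + x 1 ^ 2)⁻¹ •
        ((2 * x 0) • EuclideanSpace.proj (𝕜 := ℝ) (0 : Fin 2) +
        (2 * x 1) • EuclideanSpace.proj (𝕜 := ℝ) (1 : Fin 2))) x :=
  (hφ _).hasDerivAt.comp_hasFDerivAt x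
    (((hasFDerivAt_sq_add_sq x).log (sq_add_sq_pos hx).ne').const_mul δ)

lemma fderiv_logProfile_single_zero {φ : ℝ → ℝ} (hφ : Differentiable ℝ φ) (δ : ℝ)
    {x : EuclideanSpace ℝ (Fin 2)} (hx : x ≠ 0) :
    fderiv ℝ (logProfile φ δ) x (EuclideanSpace.single 0 1) =
      φ (δ * Real.log (x 0 ^ 2 + x 1 ^ 2)) + 2 * δ * (x 0 ^ 2 *
        (deriv φ (δ * Real.log (x 0 ^ 2 + x 1 ^ 2)) * (x 0 ^ 2 + x 1 ^ 2)⁻¹)) := by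
  have h := (hasFDerivAt_coord 0 x).mul (hasFDerivAt_comp_log hφ δ hx)
  have h' : fderiv ℝ (logProfile φ δ) x = _ := h.fderiv
  rw [h']
  simp
  ring

lemma fderiv_logProfile_single_one {φ : ℝ → ℝ} (hφ : Differentiable ℝ φ) (δ : ℝ)
    {x : EuclideanSpace ℝ (Fin 2)} (hx : x ≠ 0) :
    fderiv ℝ (logProfile φ δ) x (EuclideanSpace.single 1 1) =
      2 * δ * (x 0 * x 1 *
        (deriv φ (δ * Real.log (x 0 ^ 2 + x 1 ^ 2)) * (x 0 ^ 2 + x 1 ^ 2)⁻¹)) := by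
  have h := (hasFDerivAt_coord 0 x).mul (hasFDerivAt_comp_log hφ δ hx)
  have h' : fderiv ℝ (logProfile φ δ) x = _ := h.fderiv
  rw [h']
  simp
  ring

lemma contDiffAt_logProfile {φ : ℝ → ℝ} (hφ : ContDiff ℝ 2 φ) (δ : ℝ)
    {x : EuclideanSpace ℝ (Fin 2)} (hx : x ≠ 0) : ContDiffAt ℝ 2 (logProfile φ δ) x := by
  have hc (i : Fin 2) : ContDiffAt ℝ 2 (fun y : EuclideanSpace ℝ (Fin 2) ↦ y i) x :=
    (EuclideanSpace.proj (𝕜 := ℝ) i : EuclideanSpace ℝ (Fin 2) →L[ℝ] ℝ).contDiff.contDiffAt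
  exact (hc 0).mul (hφ.contDiffAt.comp x (contDiffAt_const.mul
    ((((hc 0).pow 2).add ((hc 1).pow 2)).log (sq_add_sq_pos hx).ne')))

lemma iteratedFDeriv_two_eq_fderiv_of_eventuallyEq
    {u F : EuclideanSpace ℝ (Fin 2) → ℝ} {x v : EuclideanSpace ℝ (Fin 2)}
    {F' : EuclideanSpace ℝ (Fin 2) →L[ℝ] ℝ}
    (hu : ContDiffAt ℝ 2 u x) (h : (fun y ↦ fderiv ℝ u y v) =ᶠ[𝓝 x] F)
    (hF : HasFDerivAt F F' x) : iteratedFDeriv ℝ 2 u x ![v, v] = F' v := by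
  have hd : DifferentiableAt ℝ (fderiv ℝ u) x :=
    (hu.fderiv_right (m := 1) (by norm_num)).differentiableAt (by norm_num)
  have h2 := (hd.hasFDerivAt.clm_apply (hasFDerivAt_const v x)).unique
    (hF.congr_of_eventuallyEq h)
  rw [iteratedFDeriv_two_apply, ← h2]
  simp

lemma lap_logProfile {φ : ℝ → ℝ} (hφ : ContDiff ℝ 2 φ) (δ : ℝ)
    {x : EuclideanSpace ℝ (Fin 2)} (hx : x ≠ 0) :
    lap (logProfile φ δ) x = x 0 * (x 0 ^ 2 + x 1 ^ 2)⁻¹ *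
      (4 * δ * deriv φ (δ * Real.log (x 0 ^ 2 + x 1 ^ 2)) +
        4 * δ ^ 2 * deriv (deriv φ) (δ * Real.log (x 0 ^ 2 + x 1 ^ 2))) := by
  have hφ1 : Differentiable ℝ φ := hφ.differentiable (by norm_num)
  have hφ2 : Differentiable ℝ (deriv φ) := by
    have : ContDiff ℝ (1 + 1) φ := by simpa [one_add_one_eq_two] using hφ
    exact (contDiff_succ_iff_deriv.1 this).2.2.differentiable (by norm_num)
  have hq := (sq_add_sq_pos hx).ne'
  have hne : ∀ᶠ y in 𝓝 x, y ≠ 0 := isOpen_ne.mem_nhds hx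
  have hinv := (hasDerivAt_inv hq).comp_hasFDerivAt x (hasFDerivAt_sq_add_sq x)
  have hG := (hasFDerivAt_comp_log hφ2 δ hx).mul hinv
  have h0 := iteratedFDeriv_two_eq_fderiv_of_eventuallyEq (contDiffAt_logProfile hφ δ hx)
    (hne.mono fun y hy ↦ fderiv_logProfile_single_zero hφ1 δ hy)
    ((hasFDerivAt_comp_log hφ1 δ hx).add
      ((((hasFDerivAt_coord 0 x).pow 2).mul hG).const_mul (2 * δ)))
  have h1 := iteratedFDeriv_two_eq_fderiv_of_eventuallyEq (contDiffAt_logProfile hφ δ hx)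
    (hne.mono fun y hy ↦ fderiv_logProfile_single_one hφ1 δ hy)
    ((((hasFDerivAt_coord 0 x).mul (hasFDerivAt_coord 1 x)).mul hG).const_mul (2 * δ))
  rw [lap, Fin.sum_univ_two, h0, h1]
  simp
  field_simp
  ring

lemma sq_lap_logProfile_le {φ : ℝ → ℝ} (hφ : ContDiff ℝ 2 φ) {δ M : ℝ} (hδ : 0 < δ) (hδ1 : δ ≤ 1)
    (h1 : ∀ t, |deriv φ t| ≤ M) (h2 : ∀ t, |deriv (deriv φ) t| ≤ M)
    {x : EuclideanSpace ℝ (Fin 2)} (hx : x ≠ 0) :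
    lap (logProfile φ δ) x ^ 2 ≤ 64 * δ ^ 2 * M ^ 2 * ‖x‖ ^ (-2 : ℝ) := by
  rw [lap_logProfile hφ δ hx, Real.rpow_neg (norm_nonneg _), Real.rpow_two,
    ← sq_add_sq_eq_norm_sq]
  have hq := sq_add_sq_pos hx
  set q := x 0 ^ 2 + x 1 ^ 2
  set A := deriv φ (δ * Real.log q)
  set B := deriv (deriv φ) (δ * Real.log q)
  have hM : 0 ≤ M := (abs_nonneg _).trans (h1 0)
  have hB : |δ * B| ≤ M := by
    rw [abs_mul, abs_of_pos hδ]
    calc δ * |B| ≤ 1 * M := mul_le_mul hδ1 (h2 _) (abs_nonneg _) zero_le_one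
      _ = M := one_mul M
  have hAB : (A + δ * B) ^ 2 ≤ (2 * M) ^ 2 := by
    refine sq_le_sq' ?_ ?_ <;>
      linarith [(abs_le.1 (h1 (δ * Real.log q))).1, (abs_le.1 (h1 (δ * Real.log q))).2,
        (abs_le.1 hB).1, (abs_le.1 hB).2]
  have hx0 : x 0 ^ 2 * q⁻¹ ≤ 1 := by
    rw [← div_eq_mul_inv, div_le_one hq]
    nlinarith [sq_nonneg (x 1)]
  calc (x 0 * q⁻¹ * (4 * δ * A + 4 * δ ^ 2 * B)) ^ 2
      = (x 0 ^ 2 * q⁻¹) * (16 * δ ^ 2 * q⁻¹ * (A + δ * B) ^ 2) := by ring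
    _ ≤ 1 * (16 * δ ^ 2 * q⁻¹ * (2 * M) ^ 2) := by gcongr
    _ = 64 * δ ^ 2 * M ^ 2 * q⁻¹ := by ring

lemma mul_log_sq_add_sq (δ : ℝ) (x : EuclideanSpace ℝ (Fin 2)) :
    δ * Real.log (x 0 ^ 2 + x 1 ^ 2) = 2 * δ * Real.log ‖x‖ := by
  rw [sq_add_sq_eq_norm_sq, Real.log_pow]
  push_cast
  ring

lemma logProfile_eq_zero {φ : ℝ → ℝ} (hφ : ∀ t, 2 ≤ |t| → φ t = 0) {δ : ℝ} (hδ : 0 < δ)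
    {x : EuclideanSpace ℝ (Fin 2)} (hx : ‖x‖ ∉ Icc (Real.exp (-(1 / δ))) (Real.exp (1 / δ))) :
    logProfile φ δ x = 0 := by
  rcases eq_or_ne x 0 with rfl | h0
  · simp [logProfile]
  rw [logProfile, mul_log_sq_add_sq, hφ, mul_zero]
  have hpos : 0 < ‖x‖ := norm_pos_iff.2 h0
  by_contra! h
  have h' := abs_lt.1 h
  refine hx ⟨?_, ?_⟩
  · rw [← Real.le_log_iff_exp_le hpos, neg_le, ← neg_le_neg_iff, neg_neg, neg_le, le_div_iff₀ hδ]
    linarith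
  · rw [← Real.log_le_iff_le_exp hpos, le_div_iff₀ hδ]
    linarith

lemma tsupport_logProfile_subset {φ : ℝ → ℝ} (hφ : ∀ t, 2 ≤ |t| → φ t = 0) {δ : ℝ}
    (hδ : 0 < δ) : tsupport (logProfile φ δ) ⊆
      {x | ‖x‖ ∈ Icc (Real.exp (-(1 / δ))) (Real.exp (1 / δ))} := by
  refine closure_minimal (fun x hx ↦ ?_) (isClosed_Icc.preimage continuous_norm)
  by_contra h
  exact hx (logProfile_eq_zero hφ hδ h)

lemma one_le_norm_gradient_logProfile {φ : ℝ → ℝ} (hφ : Differentiable ℝ φ)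
    (h1 : ∀ t, |t| < 1 → φ t = 1) {δ : ℝ} (hδ : 0 < δ) {x : EuclideanSpace ℝ (Fin 2)}
    (hx : ‖x‖ ∈ Ioc (Real.exp (-(1 / (4 * δ)))) (Real.exp (1 / (4 * δ)))) :
    1 ≤ ‖gradient (logProfile φ δ) x‖ := by
  have hpos : 0 < ‖x‖ := (Real.exp_pos _).trans hx.1
  have ht : |2 * δ * Real.log ‖x‖| < 1 := by
    have h1 := (Real.lt_log_iff_exp_lt hpos).2 hx.1
    have h2 := (Real.log_le_iff_le_exp hpos).2 hx.2
    rw [le_div_iff₀ (by positivity)] at h2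
    rw [← neg_div, div_lt_iff₀ (by positivity)] at h1
    rw [abs_lt]
    constructor <;> linarith
  have hd : deriv φ (2 * δ * Real.log ‖x‖) = 0 := by
    have : φ =ᶠ[𝓝 (2 * δ * Real.log ‖x‖)] fun _ ↦ 1 :=
      (continuous_abs.continuousAt.eventually_lt_const ht).mono h1
    rw [this.deriv_eq, deriv_const]
  have hf := fderiv_logProfile_single_zero hφ δ (norm_pos_iff.1 hpos)
  rw [mul_log_sq_add_sq, hd, h1 _ ht] at hf
  have hn := (fderiv ℝ (logProfile φ δ) x).le_opNorm (EuclideanSpace.single 0 1)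
  rw [hf, ← toDual_gradient, LinearIsometryEquiv.norm_map] at hn
  simpa using hn

lemma exists_log_cutoff : ∃ φ : ℝ → ℝ, ContDiff ℝ 2 φ ∧ (∀ t, |t| < 1 → φ t = 1) ∧
    (∀ t, 2 ≤ |t| → φ t = 0) ∧
    ∃ M, (∀ t, |deriv φ t| ≤ M) ∧ ∀ t, |deriv (deriv φ) t| ≤ M := by
  let f : ContDiffBump (0 : ℝ) := ⟨1, 2, one_pos, one_lt_two⟩
  have hf : ContDiff ℝ (1 + 1) f := f.contDiff
  have hf1 := (contDiff_succ_iff_deriv.1 hf).2.2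
  obtain ⟨M₁, h₁⟩ := f.hasCompactSupport.deriv.exists_bound_of_continuous hf1.continuous
  obtain ⟨M₂, h₂⟩ := f.hasCompactSupport.deriv.deriv.exists_bound_of_continuous
    (hf1.continuous_deriv le_rfl)
  refine ⟨f, f.contDiff, fun t ht ↦ f.one_of_mem_closedBall ?_, fun t ht ↦ f.zero_of_le_dist ?_,
    max M₁ M₂, fun t ↦ (h₁ t).trans (le_max_left _ _), fun t ↦ (h₂ t).trans (le_max_right _ _)⟩
  · simpa [f] using ht.le
  · simpa [f] using ht

lemma integrable_norm_rpow_mul_norm_gradient_sq {u : EuclideanSpace ℝ (Fin 2) → ℝ}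
    (hu : ContDiff ℝ 1 u) (hc : HasCompactSupport u)
    (h0 : (0 : EuclideanSpace ℝ (Fin 2)) ∉ tsupport u) (s : ℝ) :
    Integrable fun x : EuclideanSpace ℝ (Fin 2) ↦ ‖x‖ ^ s * ‖gradient u x‖ ^ 2 := by
  have hg (x) : ‖gradient u x‖ = ‖fderiv ℝ u x‖ := by
    rw [← toDual_gradient, LinearIsometryEquiv.norm_map]
  simp_rw [hg]
  have hcont := hu.continuous_fderiv one_ne_zero
  refine Continuous.integrable_of_hasCompactSupport ?_ ?_
  · refine continuous_iff_continuousAt.2 fun x ↦ ?_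
    rcases eq_or_ne x 0 with rfl | hx
    · have : (fun x ↦ ‖x‖ ^ s * ‖fderiv ℝ u x‖ ^ 2) =ᶠ[𝓝 0] fun _ ↦ 0 := by
        filter_upwards [(isClosed_tsupport u).isOpen_compl.mem_nhds h0] with y hy
        have : fderiv ℝ u y = 0 := by
          by_contra h
          exact hy (support_fderiv_subset ℝ h)
        simp [this]
      exact continuousAt_const.congr this.symm
    · exact (continuous_norm.continuousAt.rpow_const (Or.inl (norm_ne_zero_iff.2 hx))).mul
        (hcont.norm.pow 2).continuousAt
  · refine (hc.fderiv ℝ).mono fun x hx h ↦ hx ?_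
    simp [h]

theorem statement8 (ε : ℝ) (hε : 0 < ε) :
    ∃ u : EuclideanSpace ℝ (Fin 2) → ℝ,
      ContDiff ℝ 2 u ∧ HasCompactSupport u ∧
      (0 : EuclideanSpace ℝ (Fin 2)) ∉ tsupport u ∧
      (∫ x : EuclideanSpace ℝ (Fin 2), ‖x‖ ^ (-2 : ℝ) * ‖gradient u x‖ ^ 2) ≠ 0 ∧
      (∫ x : EuclideanSpace ℝ (Fin 2), (lap u x) ^ 2) <
        ε * (∫ x : EuclideanSpace ℝ (Fin 2), ‖x‖ ^ (-2 : ℝ) * ‖gradient u x‖ ^ 2) := by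
  obtain ⟨φ, hφ, hφ1, hφ0, M, hM1, hM2⟩ := exists_log_cutoff
  obtain ⟨δ, hδ, hδ1, hδε⟩ : ∃ δ : ℝ, 0 < δ ∧ δ ≤ 1 ∧ 384 * δ ^ 2 * M ^ 2 < ε := by
    refine ⟨min 1 (ε / (384 * M ^ 2 + 1)), by positivity, min_le_left _ _, ?_⟩
    have h := min_le_right 1 (ε / (384 * M ^ 2 + 1))
    have hp : 0 < min 1 (ε / (384 * M ^ 2 + 1)) := by positivity
    have h1 := min_le_left 1 (ε / (384 * M ^ 2 + 1))
    rw [le_div_iff₀ (by positivity)] at h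
    set d := min 1 (ε / (384 * M ^ 2 + 1))
    have hd : d ^ 2 ≤ d := by nlinarith
    have := mul_le_mul_of_nonneg_right hd (sq_nonneg M)
    linarith
  have hsub := tsupport_logProfile_subset hφ0 hδ
  have h0 : (0 : EuclideanSpace ℝ (Fin 2)) ∉ tsupport (logProfile φ δ) := fun h ↦ by
    have := (hsub h).1
    rw [norm_zero] at this
    exact (Real.exp_pos _).not_ge this
  have hcs : HasCompactSupport (logProfile φ δ) :=
    HasCompactSupport.of_support_subset_isCompact
      (isCompact_closedBall 0 (Real.exp (1 / δ)))
      fun x hx ↦ mem_closedBall_zero_iff.2 (hsub (subset_tsupport _ hx)).2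
  have hu : ContDiff ℝ 2 (logProfile φ δ) := by
    refine contDiff_iff_contDiffAt.2 fun x ↦ ?_
    rcases eq_or_ne x 0 with rfl | hx
    · exact contDiffAt_const.congr_of_eventuallyEq (notMem_tsupport_iff_eventuallyEq.1 h0)
    · exact contDiffAt_logProfile hφ δ hx
  set c := 2 * volume.real (Metric.ball (0 : EuclideanSpace ℝ (Fin 2)) 1) with hc
  have hcpos : 0 < c := mul_pos two_pos
    (ENNReal.toReal_pos (Metric.measure_ball_pos volume _ one_pos).ne' measure_ball_lt_top.ne)
  have hlow : c * (1 / (2 * δ)) ≤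
      ∫ x, ‖x‖ ^ (-2 : ℝ) * ‖gradient (logProfile φ δ) x‖ ^ 2 := by
    have hle : Real.exp (-(1 / (4 * δ))) ≤ Real.exp (1 / (4 * δ)) :=
      Real.exp_le_exp.2 (neg_le_self (by positivity))
    have hI := integral_annulus_norm_rpow_neg_two (Real.exp_pos (-(1 / (4 * δ)))) hle
    rw [← Real.exp_sub, Real.log_exp, ← hc] at hI
    calc c * (1 / (2 * δ)) = c * (1 / (4 * δ) - -(1 / (4 * δ))) := by ring
      _ ≤ _ := by
        rw [← hI]
        refine integral_mono (integrable_annulus_norm_rpow_neg_two (Real.exp_pos _))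
          (integrable_norm_rpow_mul_norm_gradient_sq (hu.of_le one_le_two) hcs h0 _) fun x ↦ ?_
        refine indicator_apply_le' (fun hx ↦ ?_) fun _ ↦ by positivity
        exact le_mul_of_one_le_right (by positivity) (one_le_pow₀
          (one_le_norm_gradient_logProfile (hφ.differentiable two_ne_zero) hφ1 hδ hx))
  have hupp : ∫ x, lap (logProfile φ δ) x ^ 2 ≤ 64 * δ ^ 2 * M ^ 2 * (c * (3 / δ)) := by
    have hle : Real.exp (-(2 / δ)) ≤ Real.exp (1 / δ) :=
      Real.exp_le_exp.2 ((neg_nonpos.2 (by positivity)).trans (by positivity))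
    have hI := integral_annulus_norm_rpow_neg_two (Real.exp_pos (-(2 / δ))) hle
    rw [← Real.exp_sub, Real.log_exp, ← hc] at hI
    rw [show 3 / δ = 1 / δ - -(2 / δ) by ring, ← hI, ← integral_const_mul]
    refine integral_mono_of_nonneg (ae_of_all _ fun x ↦ sq_nonneg _)
      ((integrable_annulus_norm_rpow_neg_two (Real.exp_pos _)).const_mul _)
      (ae_of_all _ fun x ↦ ?_)
    by_cases hx : x ∈ tsupport (logProfile φ δ)
    · have hmem : ‖x‖ ∈ Ioc (Real.exp (-(2 / δ))) (Real.exp (1 / δ)) := by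
        refine ⟨lt_of_lt_of_le (Real.exp_lt_exp.2 (neg_lt_neg ?_)) (hsub hx).1, (hsub hx).2⟩
        gcongr
        norm_num
      simp only [indicator_of_mem hmem]
      exact sq_lap_logProfile_le hφ hδ hδ1 hM1 hM2 (ne_of_mem_of_not_mem hx h0)
    · have : iteratedFDeriv ℝ 2 (logProfile φ δ) x = 0 := by
        by_contra h
        exact hx (support_iteratedFDeriv_subset 2 h)
      simp only [lap, this, zero_apply, Finset.sum_const_zero]
      rw [zero_pow two_ne_zero]
      exact mul_nonneg (by positivity) (indicator_apply_nonneg fun _ ↦ by positivity)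
  have hlow_pos : 0 < c * (1 / (2 * δ)) := by positivity
  refine ⟨logProfile φ δ, hu, hcs, h0, (hlow_pos.trans_le hlow).ne', ?_⟩
  calc _ ≤ 64 * δ ^ 2 * M ^ 2 * (c * (3 / δ)) := hupp
    _ = 384 * δ ^ 2 * M ^ 2 * (c * (1 / (2 * δ))) := by
      field_simp
      ring
    _ < ε * (c * (1 / (2 * δ))) := by gcongr
    _ ≤ _ := by gcongr
end
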